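/- arXiv:2104.05063 — 3 statements merged into one kernel-verified Lean document; each statement's English description precedes it below -/
import Mathlib

section
/- Let $(X_0,X_1)$ be an interpolation couple of Banach spaces, let $\xi_0<0<\xi_1$ be real numbers, $1\le p_0,p_1<\infty$, and set $\theta=\xi_0/(\xi_0-\xi_1)$ and $1/p=(1-\theta)/p_0+\theta/p_1$. Then $x\in(X_0,X_1)_{\theta,p}$ if and only if there exist measurable functions $u_j:(0,\infty)\to X_j$ ($j=0,1$) with $t\mapsto t^{\xi_j}u_j(t)\in L^{p_j}((0,\infty),dt/t;X_j)$ and $x=u_0(t)+u_1(t)$ for a.e.\ $t>0$; moreover $\|x\|_{(X_0,X_1)_{\theta,p}}$ is equivalent to the infimum of $\sum_{j}\|t\mapsto t^{\xi_j}u_j(t)\|_{L^{p_j}(dt/t;X_j)}$ over all such decompositions. -/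
open MeasureTheory Set ENNReal Filter

noncomputable section

variable {X0 X1 V : Type*}

/-- The K-functional of an interpolation couple `(X0, X1)` of Banach spaces, realized
via continuous linear injections `i0 : X0 → V`, `i1 : X1 → V` into a common Hausdorff
topological vector space `V`. -/
def Kfun [NormedAddCommGroup X0] [NormedSpace ℝ X0]
    [NormedAddCommGroup X1] [NormedSpace ℝ X1]
    [AddCommGroup V] [Module ℝ V]
    (i0 : X0 →ₗ[ℝ] V) (i1 : X1 →ₗ[ℝ] V) (t : ℝ) (x : V) : ℝ≥0∞ :=
  ⨅ (y : X0) (z : X1) (_ : x = i0 y + i1 z),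
    (‖y‖₊ : ℝ≥0∞) + ENNReal.ofReal t * (‖z‖₊ : ℝ≥0∞)

/-- The (extended) norm of the real interpolation space `(X0, X1)_{θ,p}` (K-method). -/
def interpNorm [NormedAddCommGroup X0] [NormedSpace ℝ X0]
    [NormedAddCommGroup X1] [NormedSpace ℝ X1]
    [AddCommGroup V] [Module ℝ V]
    (i0 : X0 →ₗ[ℝ] V) (i1 : X1 →ₗ[ℝ] V) (θ p : ℝ) (x : V) : ℝ≥0∞ :=
  (∫⁻ t in Ioi (0:ℝ),
      (ENNReal.ofReal (t ^ (-θ)) * Kfun i0 i1 t x) ^ p * (ENNReal.ofReal t)⁻¹) ^ (1 / p)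

/-- The weighted norm `‖t ↦ t^ξ u(t)‖_{L^q((0,∞), dt/t; W)}`. -/
def powWeightedNorm {W : Type*} [NormedAddCommGroup W] (ξ q : ℝ) (u : ℝ → W) : ℝ≥0∞ :=
  (∫⁻ t in Ioi (0:ℝ),
      (ENNReal.ofReal (t ^ ξ) * (‖u t‖₊ : ℝ≥0∞)) ^ q * (ENNReal.ofReal t)⁻¹) ^ (1 / q)


lemma lint_exp_lt (M : ℝ≥0∞) (hM : M ≠ ⊤) (q : ℝ) (hq : 0 < q) :
    ∫⁻ a : ℝ, (if ENNReal.ofReal (Real.exp a) < M then ENNReal.ofReal (Real.exp (q * a)) else 0)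
      = ENNReal.ofReal (1 / q) * M ^ q := by
  lift M to NNReal using hM
  rcases eq_or_lt_of_le (show 0 ≤ M from bot_le) with h0 | h0
  · subst h0
    simp [ENNReal.zero_rpow_of_pos hq]
  · have h0' : (0:ℝ) < M := h0
    have hset : ∀ a : ℝ, ENNReal.ofReal (Real.exp a) < (M : ℝ≥0∞) ↔ a ∈ Iio (Real.log M) := by
      intro a
      rw [← ENNReal.ofReal_coe_nnreal, ENNReal.ofReal_lt_ofReal_iff h0', mem_Iio,
        Real.lt_log_iff_exp_lt h0']
    have : (fun a : ℝ => (if ENNReal.ofReal (Real.exp a) < (M : ℝ≥0∞) then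
        ENNReal.ofReal (Real.exp (q * a)) else 0)) =
        (Iio (Real.log M)).indicator (fun a => ENNReal.ofReal (Real.exp (q * a))) := by
      funext a
      rw [indicator_apply]
      exact if_congr (hset a) rfl rfl
    rw [this, lintegral_indicator measurableSet_Iio, setLIntegral_congr Iio_ae_eq_Iic,
      ← ofReal_integral_eq_lintegral_ofReal (integrableOn_exp_mul_Iic hq _)
        (Eventually.of_forall fun x => (Real.exp_pos _).le), integral_exp_mul_Iic hq,
      ← ENNReal.ofReal_coe_nnreal, ENNReal.ofReal_rpow_of_pos h0', ← ENNReal.ofReal_mul (by positivity),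
      Real.rpow_def_of_pos h0']
    congr 1
    rw [mul_comm q]
    ring

lemma lint_exp_lt_one (M : ℝ≥0∞) :
    ∫⁻ a : ℝ, (if ENNReal.ofReal (Real.exp a) < M then ENNReal.ofReal (Real.exp a) else 0)
      ≤ M := by
  by_cases hM : M = ⊤
  · simp [hM]
  · have := lint_exp_lt M hM 1 one_pos
    simp only [one_mul, div_one, ENNReal.ofReal_one, ENNReal.rpow_one] at this
    exact this.le

lemma lint_log (g : ℝ → ℝ≥0∞) :
    ∫⁻ t in Ioi (0:ℝ), g t * (ENNReal.ofReal t)⁻¹ = ∫⁻ τ : ℝ, g (Real.exp τ) := by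
  have h := lintegral_image_eq_lintegral_abs_deriv_mul (s := univ) (f := Real.exp)
    (f' := Real.exp) MeasurableSet.univ
    (fun x _ => (Real.hasDerivAt_exp x).hasDerivWithinAt) Real.exp_injective.injOn
    (fun t => g t * (ENNReal.ofReal t)⁻¹)
  rw [image_univ, Real.range_exp] at h
  rw [h, setLIntegral_univ]
  refine lintegral_congr fun τ => ?_
  rw [abs_of_pos (Real.exp_pos _), mul_comm, mul_assoc, ENNReal.inv_mul_cancel, mul_one]
  · simp [Real.exp_pos]
  · simp

lemma ae_exp {P : ℝ → Prop} (h : ∀ᵐ t ∂(volume.restrict (Ioi (0:ℝ))), P t) :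
    ∀ᵐ τ : ℝ, P (Real.exp τ) := by
  rw [ae_restrict_iff' measurableSet_Ioi] at h
  rw [ae_iff] at h ⊢
  have h2 := addHaar_image_eq_zero_of_differentiableOn_of_addHaar_eq_zero (μ := volume)
    (f := Real.log) (s := {a : ℝ | ¬(a ∈ Ioi (0:ℝ) → P a)}) ?_ h
  · refine measure_mono_null ?_ h2
    intro τ hτ
    exact ⟨Real.exp τ, by simpa [Real.exp_pos] using hτ, Real.log_exp τ⟩
  · intro a ha
    have : 0 < a := by
      by_contra hc
      exact ha (fun h => absurd h hc)
    exact (Real.differentiableAt_log this.ne').differentiableWithinAt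

lemma lint_lin (a b c d : ℝ) (hdet : 0 < a * d - b * c) (F : ℝ × ℝ → ℝ≥0∞) (hF : Measurable F) :
    ∫⁻ σ : ℝ, ∫⁻ r : ℝ, F (σ, r) = ENNReal.ofReal (a * d - b * c) *
      ∫⁻ τ : ℝ, ∫⁻ ρ : ℝ, F (a * τ + b * ρ, c * τ + d * ρ) := by
  let f := Matrix.toLin (Module.Basis.finTwoProd ℝ) (Module.Basis.finTwoProd ℝ) !![a, b; c, d]
  have hd : LinearMap.det f = a * d - b * c := by
    simp only [f]
    rw [LinearMap.det_toLin, Matrix.det_fin_two_of]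
  have hmap := Measure.map_linearMap_addHaar_eq_smul_addHaar (volume : Measure (ℝ × ℝ)) (f := f)
    (by rw [hd]; exact hdet.ne')
  have hfm : Measurable f := (LinearMap.continuous_of_finiteDimensional f).measurable
  have h1 : ∫⁻ z, F z ∂(Measure.map f (volume : Measure (ℝ × ℝ))) = ∫⁻ z, F (f z) :=
    lintegral_map hF hfm
  rw [hmap, lintegral_smul_measure, hd, abs_of_pos (inv_pos.2 hdet)] at h1
  have e1 : ∫⁻ z : ℝ × ℝ, F z = ∫⁻ σ : ℝ, ∫⁻ r : ℝ, F (σ, r) := by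
    rw [Measure.volume_eq_prod, lintegral_prod _ hF.aemeasurable]
  have e2 : ∫⁻ z : ℝ × ℝ, F (f z) = ∫⁻ τ : ℝ, ∫⁻ ρ : ℝ, F (a * τ + b * ρ, c * τ + d * ρ) := by
    rw [Measure.volume_eq_prod, lintegral_prod (fun z => F (f z)) (hF.comp hfm).aemeasurable]
    simp only [f, Matrix.toLin_finTwoProd_apply]
  rw [← e1, ← e2, ← h1, smul_eq_mul, ← mul_assoc, ← ENNReal.ofReal_mul hdet.le,
    mul_inv_cancel₀ hdet.ne', ENNReal.ofReal_one, one_mul]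

/-- The doubly logarithmic integrand. -/
def Gfun (ξ0 ξ1 p0 p1 : ℝ) (k : ℝ → ℝ≥0∞) (τ ρ : ℝ) : ℝ≥0∞ :=
  if ENNReal.ofReal (Real.exp (-ξ0 * τ + p0⁻¹ * ρ)) < k ((ξ1 - ξ0) * τ + (p0⁻¹ - p1⁻¹) * ρ)
    then ENNReal.ofReal (Real.exp ρ) else 0

lemma Gfun_meas (ξ0 ξ1 p0 p1 : ℝ) (k : ℝ → ℝ≥0∞) (hk : Measurable k) :
    Measurable (fun z : ℝ × ℝ => Gfun ξ0 ξ1 p0 p1 k z.1 z.2) := by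
  unfold Gfun
  refine Measurable.ite (measurableSet_lt ?_ (hk.comp ?_)) ?_ measurable_const <;> fun_prop

lemma core_identity (ξ0 ξ1 p0 p1 θ p : ℝ) (hξ0 : ξ0 < 0) (hξ1 : 0 < ξ1)
    (hp0 : 1 ≤ p0) (hp1 : 1 ≤ p1) (hp : 0 < p)
    (hθ : θ = ξ0 / (ξ0 - ξ1)) (hpp : 1 / p = (1 - θ) / p0 + θ / p1)
    (k : ℝ → ℝ≥0∞) (hk : Measurable k) (hkt : ∀ σ, k σ ≠ ⊤) :
    ENNReal.ofReal (1 / p) * ∫⁻ σ : ℝ, (ENNReal.ofReal (Real.exp (-θ * σ)) * k σ) ^ p =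
      ENNReal.ofReal (ξ1 / p0 - ξ0 / p1) * ∫⁻ τ : ℝ, ∫⁻ ρ : ℝ, Gfun ξ0 ξ1 p0 p1 k τ ρ := by
  have hp0' : 0 < p0 := by linarith
  have hp1' : 0 < p1 := by linarith
  let F : ℝ × ℝ → ℝ≥0∞ := fun z => if ENNReal.ofReal (Real.exp z.2) < k z.1
    then ENNReal.ofReal (Real.exp (p * z.2 - θ * p * z.1)) else 0
  have hF : Measurable F := by
    refine Measurable.ite (measurableSet_lt ?_ (hk.comp ?_)) ?_ measurable_const <;> fun_prop
  have hdd : (ξ1 - ξ0) * p0⁻¹ - (p0⁻¹ - p1⁻¹) * (-ξ0) = ξ1 / p0 - ξ0 / p1 := by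
    field_simp; ring
  have hdpos : 0 < ξ1 / p0 - ξ0 / p1 := by
    have h1 : 0 < ξ1 / p0 := by positivity
    have h2 : ξ0 / p1 < 0 := div_neg_of_neg_of_pos hξ0 hp1'
    linarith
  have h := lint_lin (ξ1 - ξ0) (p0⁻¹ - p1⁻¹) (-ξ0) p0⁻¹ (by rw [hdd]; exact hdpos) F hF
  rw [hdd] at h
  have e1 : ∫⁻ σ : ℝ, ∫⁻ r : ℝ, F (σ, r) = ENNReal.ofReal (1 / p) *
      ∫⁻ σ : ℝ, (ENNReal.ofReal (Real.exp (-θ * σ)) * k σ) ^ p := by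
    rw [← lintegral_const_mul' _ _ ENNReal.ofReal_ne_top]
    refine lintegral_congr fun σ => ?_
    have : ∀ r, F (σ, r) = ENNReal.ofReal (Real.exp (-θ * σ)) ^ p *
        (if ENNReal.ofReal (Real.exp r) < k σ then ENNReal.ofReal (Real.exp (p * r)) else 0) := by
      intro r
      simp only [F]
      split_ifs
      · rw [ENNReal.ofReal_rpow_of_pos (Real.exp_pos _), ← ENNReal.ofReal_mul (by positivity),
          ← Real.exp_mul, ← Real.exp_add]
        congr 2; ring
      · simp
    simp only [this]
    rw [lintegral_const_mul', lint_exp_lt _ (hkt σ) p hp, ENNReal.mul_rpow_of_nonneg _ _ hp.le]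
    · ring
    · exact ENNReal.rpow_ne_top_of_nonneg hp.le ENNReal.ofReal_ne_top
  rw [← e1, h]
  congr 1
  refine lintegral_congr fun τ => lintegral_congr fun ρ => ?_
  simp only [F, Gfun]
  congr 3
  have hne : ξ0 - ξ1 ≠ 0 := by linarith
  have h1 : p * ((1 - θ) / p0 + θ / p1) = 1 := by rw [← hpp]; field_simp
  have h2 : θ * (ξ1 - ξ0) = - ξ0 := by rw [hθ]; field_simp; ring
  have : p * (-ξ0 * τ + p0⁻¹ * ρ) - θ * p * ((ξ1 - ξ0) * τ + (p0⁻¹ - p1⁻¹) * ρ)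
    = p * τ * (-ξ0 - θ * (ξ1 - ξ0)) + ρ * (p * ((1 - θ) / p0 + θ / p1)) := by
    field_simp; ring
  rw [this, h1, h2]; ring

lemma weight_half {W : Type*} [NormedAddCommGroup W] (ξ q τ ρ : ℝ) (hq : 1 ≤ q) (y : W)
    (h : (2 * (ENNReal.ofReal (Real.exp τ ^ ξ) * (‖y‖₊ : ℝ≥0∞))) ^ q
      ≤ ENNReal.ofReal (Real.exp ρ)) :
    2 * ‖y‖ ≤ Real.exp (q⁻¹ * ρ - ξ * τ) := by
  have hq0 : 0 < q := by linarith
  have hy : (‖y‖₊ : ℝ≥0∞) = ENNReal.ofReal ‖y‖ := by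
    rw [← coe_nnnorm, ENNReal.ofReal_coe_nnreal]
  have h2 : (2 : ℝ≥0∞) = ENNReal.ofReal 2 := by simp
  have hn : 0 ≤ 2 * (Real.exp τ ^ ξ * ‖y‖) := by positivity
  rw [hy, h2, ← ENNReal.ofReal_mul (by positivity), ← ENNReal.ofReal_mul (by positivity),
    ENNReal.ofReal_rpow_of_nonneg hn hq0.le,
    ENNReal.ofReal_le_ofReal_iff (by positivity)] at h
  have h3 := Real.rpow_le_rpow (by positivity) h (inv_nonneg.2 hq0.le)
  rw [← Real.rpow_mul hn, mul_inv_cancel₀ hq0.ne', Real.rpow_one, ← Real.exp_mul,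
    ← Real.exp_mul] at h3
  rw [Real.exp_sub, le_div_iff₀ (Real.exp_pos _), mul_comm q⁻¹, mul_comm ξ]
  linarith

lemma weight_two {W : Type*} [NormedAddCommGroup W] (ξ q τ ρ : ℝ) (hq : 1 ≤ q) (y : W)
    (h : ‖y‖ ≤ 2 * Real.exp (q⁻¹ * ρ - ξ * τ)) :
    (ENNReal.ofReal (Real.exp τ ^ ξ) * (‖y‖₊ : ℝ≥0∞)) ^ q
      ≤ 2 ^ q * ENNReal.ofReal (Real.exp ρ) := by
  have hq0 : 0 < q := by linarith
  have hy : (‖y‖₊ : ℝ≥0∞) = ENNReal.ofReal ‖y‖ := by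
    rw [← coe_nnnorm, ENNReal.ofReal_coe_nnreal]
  have h2 : (2 : ℝ≥0∞) = ENNReal.ofReal 2 := by simp
  have e : ENNReal.ofReal (Real.exp ρ) = (ENNReal.ofReal (Real.exp (q⁻¹ * ρ))) ^ q := by
    rw [ENNReal.ofReal_rpow_of_pos (Real.exp_pos _), ← Real.exp_mul]
    congr 2; field_simp
  rw [e, ← ENNReal.mul_rpow_of_nonneg _ _ hq0.le]
  refine ENNReal.rpow_le_rpow ?_ hq0.le
  rw [hy, h2, ← ENNReal.ofReal_mul (by positivity), ← ENNReal.ofReal_mul (by positivity)]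
  refine ENNReal.ofReal_le_ofReal ?_
  rw [Real.exp_sub, mul_div_assoc', le_div_iff₀ (Real.exp_pos _)] at h
  rw [← Real.exp_mul, mul_comm τ]
  linarith

lemma weight_int_le {W : Type*} [NormedAddCommGroup W] (ξ q : ℝ) (hq : 0 < q) (u : ℝ → W)
    (hP : powWeightedNorm ξ q u ≤ 1) :
    ∫⁻ t in Ioi (0:ℝ), (2 * (ENNReal.ofReal (t ^ ξ) * (‖u t‖₊ : ℝ≥0∞))) ^ q *
        (ENNReal.ofReal t)⁻¹ ≤ 2 ^ q := by
  have e : ∀ t : ℝ, (2 * (ENNReal.ofReal (t ^ ξ) * (‖u t‖₊ : ℝ≥0∞))) ^ q *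
      (ENNReal.ofReal t)⁻¹ = 2 ^ q * ((ENNReal.ofReal (t ^ ξ) * (‖u t‖₊ : ℝ≥0∞)) ^ q *
      (ENNReal.ofReal t)⁻¹) := by
    intro t
    rw [ENNReal.mul_rpow_of_nonneg _ _ hq.le, mul_assoc]
  simp only [e]
  rw [lintegral_const_mul' _ _ (ENNReal.rpow_ne_top_of_nonneg hq.le (by simp))]
  refine mul_le_of_le_one_right' ?_
  have h1 := ENNReal.rpow_le_one hP hq.le
  unfold powWeightedNorm at h1
  rwa [← ENNReal.rpow_mul, one_div_mul_cancel hq.ne', ENNReal.rpow_one] at h1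

section Kf

variable [NormedAddCommGroup X0] [NormedSpace ℝ X0] [NormedAddCommGroup X1] [NormedSpace ℝ X1]
    [AddCommGroup V] [Module ℝ V] (i0 : X0 →ₗ[ℝ] V) (i1 : X1 →ₗ[ℝ] V)

lemma Kfun_mono (x : V) : Monotone (fun t : ℝ => Kfun i0 i1 t x) := by
  intro s t hst
  refine iInf_mono fun y => iInf_mono fun z => iInf_mono fun _ => ?_
  gcongr

lemma Kfun_meas (x : V) : Measurable (fun τ : ℝ => Kfun i0 i1 (Real.exp τ) x) :=
  ((Kfun_mono i0 i1 x).comp Real.exp_monotone).measurable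

lemma Kfun_le (x : V) (y : X0) (z : X1) (h : x = i0 y + i1 z) (t : ℝ) (ht : 0 ≤ t) :
    Kfun i0 i1 t x ≤ ENNReal.ofReal (‖y‖ + t * ‖z‖) := by
  refine (iInf_le_of_le y (iInf_le_of_le z (iInf_le_of_le h le_rfl))).trans (le_of_eq ?_)
  rw [ENNReal.ofReal_add (by positivity) (by positivity), ENNReal.ofReal_mul ht,
    ← coe_nnnorm, ← coe_nnnorm, ENNReal.ofReal_coe_nnreal, ENNReal.ofReal_coe_nnreal]

lemma Kfun_exists (x : V) (t M : ℝ) (ht : 0 ≤ t) (hM : 0 < M)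
    (h : Kfun i0 i1 t x ≤ ENNReal.ofReal M) :
    ∃ (y : X0) (z : X1), x = i0 y + i1 z ∧ ‖y‖ ≤ 2 * M ∧ t * ‖z‖ ≤ 2 * M := by
  have h2 : Kfun i0 i1 t x < ENNReal.ofReal (2 * M) :=
    h.trans_lt ((ENNReal.ofReal_lt_ofReal_iff (by positivity)).2 (by linarith))
  unfold Kfun at h2
  simp only [iInf_lt_iff] at h2
  obtain ⟨y, z, hx, hlt⟩ := h2
  have : (‖y‖₊ : ℝ≥0∞) + ENNReal.ofReal t * (‖z‖₊ : ℝ≥0∞) = ENNReal.ofReal (‖y‖ + t * ‖z‖) := by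
    rw [ENNReal.ofReal_add (by positivity) (by positivity), ENNReal.ofReal_mul ht,
    ← coe_nnnorm, ← coe_nnnorm, ENNReal.ofReal_coe_nnreal, ENNReal.ofReal_coe_nnreal]
  rw [this, ENNReal.ofReal_lt_ofReal_iff (by positivity)] at hlt
  have h3 : 0 ≤ t * ‖z‖ := by positivity
  have h4 : 0 ≤ ‖y‖ := by positivity
  exact ⟨y, z, hx, by linarith, by linarith⟩

lemma interp_log (θ p : ℝ) (x : V) :
    interpNorm i0 i1 θ p x =
      (∫⁻ σ : ℝ, (ENNReal.ofReal (Real.exp (-θ * σ)) * Kfun i0 i1 (Real.exp σ) x) ^ p) ^ (1 / p) := by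
  unfold interpNorm
  rw [lint_log (fun t => (ENNReal.ofReal (t ^ (-θ)) * Kfun i0 i1 t x) ^ p)]
  simp only [← Real.exp_mul, mul_comm]

lemma powW_log {W : Type*} [NormedAddCommGroup W] (ξ q : ℝ) (u : ℝ → W) :
    powWeightedNorm ξ q u =
      (∫⁻ τ : ℝ, (ENNReal.ofReal (Real.exp τ ^ ξ) * (‖u (Real.exp τ)‖₊ : ℝ≥0∞)) ^ q) ^ (1 / q) := by
  unfold powWeightedNorm
  rw [lint_log (fun t => (ENNReal.ofReal (t ^ ξ) * (‖u t‖₊ : ℝ≥0∞)) ^ q)]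

lemma lemA (ξ0 ξ1 p0 p1 θ p : ℝ) (hξ0 : ξ0 < 0) (hξ1 : 0 < ξ1)
    (hp0 : 1 ≤ p0) (hp1 : 1 ≤ p1) (hp : 0 < p)
    (hθ : θ = ξ0 / (ξ0 - ξ1)) (hpp : 1 / p = (1 - θ) / p0 + θ / p1) :
    ∃ C : ℝ≥0∞, C ≠ ⊤ ∧ ∀ (x : V) (u0 : ℝ → X0) (u1 : ℝ → X1),
      AEStronglyMeasurable u0 (volume.restrict (Ioi (0:ℝ))) →
      (∀ᵐ t ∂(volume.restrict (Ioi (0:ℝ))), x = i0 (u0 t) + i1 (u1 t)) →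
      powWeightedNorm ξ0 p0 u0 ≤ 1 → powWeightedNorm ξ1 p1 u1 ≤ 1 →
      interpNorm i0 i1 θ p x ≤ C := by
  have hp0' : 0 < p0 := by linarith
  have hp1' : 0 < p1 := by linarith
  refine ⟨(ENNReal.ofReal p * (ENNReal.ofReal (ξ1 / p0 - ξ0 / p1) * (2 ^ p0 + 2 ^ p1))) ^ (1 / p),
    ?_, ?_⟩
  · refine ENNReal.rpow_ne_top_of_nonneg (by positivity) ?_
    refine ENNReal.mul_ne_top ENNReal.ofReal_ne_top (ENNReal.mul_ne_top ENNReal.ofReal_ne_top ?_)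
    refine ENNReal.add_ne_top.2 ⟨?_, ?_⟩ <;>
    exact ENNReal.rpow_ne_top_of_nonneg (by positivity) (by simp)
  intro x u0 u1 hm0 hae hP0 hP1
  rw [interp_log]
  refine ENNReal.rpow_le_rpow ?_ (by positivity)
  have hae2 := ae_exp hae
  obtain ⟨τ', hτ'⟩ := hae2.exists
  have hkt : ∀ σ, Kfun i0 i1 (Real.exp σ) x ≠ ⊤ := fun σ =>
    ne_top_of_le_ne_top ENNReal.ofReal_ne_top
      (Kfun_le i0 i1 x _ _ hτ' (Real.exp σ) (Real.exp_pos _).le)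
  have hcore := core_identity ξ0 ξ1 p0 p1 θ p hξ0 hξ1 hp0 hp1 hp hθ hpp
    (fun σ => Kfun i0 i1 (Real.exp σ) x) (Kfun_meas i0 i1 x) hkt
  set I := ∫⁻ σ : ℝ, (ENNReal.ofReal (Real.exp (-θ * σ)) * Kfun i0 i1 (Real.exp σ) x) ^ p with hI
  have hI' : I = ENNReal.ofReal p * (ENNReal.ofReal (1 / p) * I) := by
    rw [← mul_assoc, ← ENNReal.ofReal_mul hp.le, mul_one_div_cancel hp.ne', ENNReal.ofReal_one,
      one_mul]
  rw [hI', hcore]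
  gcongr
  -- main estimate
  let A : ℝ → ℝ≥0∞ := fun t => (2 * (ENNReal.ofReal (t ^ ξ0) * (‖u0 t‖₊ : ℝ≥0∞))) ^ p0
  let B : ℝ → ℝ≥0∞ := fun t => (2 * (ENNReal.ofReal (t ^ ξ1) * (‖u1 t‖₊ : ℝ≥0∞))) ^ p1
  have key : ∀ᵐ τ : ℝ, ∫⁻ ρ : ℝ, Gfun ξ0 ξ1 p0 p1 (fun σ => Kfun i0 i1 (Real.exp σ) x) τ ρ ≤
      A (Real.exp τ) + B (Real.exp τ) := by
    filter_upwards [hae2] with τ hτ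
    have hmeas : ∀ M : ℝ≥0∞, Measurable (fun ρ : ℝ =>
        if ENNReal.ofReal (Real.exp ρ) < M then ENNReal.ofReal (Real.exp ρ) else 0) := by
      intro M
      refine Measurable.ite (measurableSet_lt ?_ measurable_const) ?_ measurable_const <;> fun_prop
    calc _ ≤ ∫⁻ ρ : ℝ, ((if ENNReal.ofReal (Real.exp ρ) < A (Real.exp τ) then
              ENNReal.ofReal (Real.exp ρ) else 0) +
            (if ENNReal.ofReal (Real.exp ρ) < B (Real.exp τ) then
              ENNReal.ofReal (Real.exp ρ) else 0)) := by
          refine lintegral_mono fun ρ => ?_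
          unfold Gfun
          by_cases h1 : ENNReal.ofReal (Real.exp ρ) < A (Real.exp τ)
          · rw [if_pos h1]
            split_ifs <;> simp
          by_cases h2 : ENNReal.ofReal (Real.exp ρ) < B (Real.exp τ)
          · rw [if_pos h2]
            split_ifs <;> simp
          rw [if_neg]
          · simp
          intro h3
          have h1' := weight_half ξ0 p0 τ ρ hp0 _ (not_lt.1 h1)
          have h2' := weight_half ξ1 p1 τ ρ hp1 _ (not_lt.1 h2)
          have h4 := h3.trans_le (Kfun_le i0 i1 x _ _ hτ _ (Real.exp_pos _).le)
          have h5 := (ENNReal.ofReal_lt_ofReal_iff_of_nonneg (Real.exp_pos _).le).1 h4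
          have h6 : Real.exp ((ξ1 - ξ0) * τ + (p0⁻¹ - p1⁻¹) * ρ) * Real.exp (p1⁻¹ * ρ - ξ1 * τ)
              = Real.exp (-ξ0 * τ + p0⁻¹ * ρ) := by
            rw [← Real.exp_add]; congr 1; ring
          have h7 : Real.exp (p0⁻¹ * ρ - ξ0 * τ) = Real.exp (-ξ0 * τ + p0⁻¹ * ρ) := by
            congr 1; ring
          have h8 := mul_le_mul_of_nonneg_left h2'
            (Real.exp_pos ((ξ1 - ξ0) * τ + (p0⁻¹ - p1⁻¹) * ρ)).le
          linarith
      _ ≤ _ := by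
          rw [lintegral_add_left (hmeas _)]
          exact add_le_add (lint_exp_lt_one _) (lint_exp_lt_one _)
  refine (lintegral_mono_ae key).trans ?_
  rw [← lint_log (fun t => A t + B t)]
  simp only [add_mul]
  have hAm : AEMeasurable A (volume.restrict (Ioi (0:ℝ))) := by
    have : AEMeasurable (fun t => (‖u0 t‖₊ : ℝ≥0∞)) (volume.restrict (Ioi (0:ℝ))) := hm0.enorm
    refine AEMeasurable.pow_const (AEMeasurable.const_mul (AEMeasurable.mul ?_ this) _) _
    exact (by fun_prop : Measurable fun t : ℝ => ENNReal.ofReal (t ^ ξ0)).aemeasurable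
  have hAm2 : AEMeasurable (fun t => A t * (ENNReal.ofReal t)⁻¹) (volume.restrict (Ioi (0:ℝ))) :=
    hAm.mul (by fun_prop)
  rw [lintegral_add_left' hAm2]
  exact add_le_add (weight_int_le ξ0 p0 hp0' u0 hP0) (weight_int_le ξ1 p1 hp1' u1 hP1)

lemma step_bound {W : Type*} [NormedAddCommGroup W] (ξ q : ℝ) (hq : 1 ≤ q) (y : ℤ → W)
    (T : ℤ → ℝ) (hT : ∀ n : ℤ, T n ∈ Ico (n:ℝ) (n + 1)) (M : ℤ → ℝ≥0∞)
    (h : ∀ n, (ENNReal.ofReal (Real.exp (T n) ^ ξ) * (‖y n‖₊ : ℝ≥0∞)) ^ q ≤ 2 ^ q * M n) :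
    powWeightedNorm ξ q (fun t => y ⌊Real.log t⌋) ≤
      (ENNReal.ofReal (Real.exp |ξ|) ^ q * (2 ^ q * ∑' n, M n)) ^ (1 / q) := by
  have hq0 : 0 < q := by linarith
  rw [powW_log]
  refine ENNReal.rpow_le_rpow ?_ (by positivity)
  rw [← setLIntegral_univ, ← iUnion_Ico_intCast ℝ,
    lintegral_iUnion (fun _ => measurableSet_Ico) (pairwise_disjoint_Ico_intCast ℝ),
    ← ENNReal.tsum_mul_left, ← ENNReal.tsum_mul_left]
  refine ENNReal.tsum_le_tsum fun n => ?_
  have hb : ∀ τ ∈ Ico (n:ℝ) (n + 1), (ENNReal.ofReal (Real.exp τ ^ ξ) *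
      (‖y ⌊Real.log (Real.exp τ)⌋‖₊ : ℝ≥0∞)) ^ q ≤
      ENNReal.ofReal (Real.exp |ξ|) ^ q * (2 ^ q * M n) := by
    intro τ hτ
    have hfl : ⌊Real.log (Real.exp τ)⌋ = n := by
      rw [Real.log_exp, Int.floor_eq_iff]; exact hτ
    rw [hfl]
    refine le_trans ?_ (mul_le_mul_right (h n) _)
    rw [← ENNReal.mul_rpow_of_nonneg _ _ hq0.le]
    refine ENNReal.rpow_le_rpow ?_ hq0.le
    rw [← mul_assoc, ← ENNReal.ofReal_mul (Real.exp_pos _).le]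
    gcongr
    rw [← Real.exp_mul, ← Real.exp_mul, ← Real.exp_add, Real.exp_le_exp]
    have h1 : |τ - T n| ≤ 1 := by
      rw [abs_le]
      have := hT n
      constructor <;> linarith [this.1, this.2, hτ.1, hτ.2]
    have h2 : (τ - T n) * ξ ≤ |ξ| := by
      refine (le_abs_self _).trans ?_
      rw [abs_mul]
      exact mul_le_of_le_one_left (abs_nonneg _) h1
    linarith
  refine (setLIntegral_mono' measurableSet_Ico hb).trans ?_
  rw [setLIntegral_const, Real.volume_Ico]
  simp

lemma lemB (ξ0 ξ1 p0 p1 θ p : ℝ) (hξ0 : ξ0 < 0) (hξ1 : 0 < ξ1)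
    (hp0 : 1 ≤ p0) (hp1 : 1 ≤ p1) (hp : 0 < p)
    (hθ : θ = ξ0 / (ξ0 - ξ1)) (hpp : 1 / p = (1 - θ) / p0 + θ / p1) :
    ∃ C : ℝ≥0∞, C ≠ ⊤ ∧ ∀ (x : V), (∃ (y : X0) (z : X1), x = i0 y + i1 z) →
      interpNorm i0 i1 θ p x ≤ 1 → ∃ (u0 : ℝ → X0) (u1 : ℝ → X1),
      AEStronglyMeasurable u0 (volume.restrict (Ioi (0:ℝ))) ∧
      AEStronglyMeasurable u1 (volume.restrict (Ioi (0:ℝ))) ∧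
      (∀ᵐ t ∂(volume.restrict (Ioi (0:ℝ))), x = i0 (u0 t) + i1 (u1 t)) ∧
      powWeightedNorm ξ0 p0 u0 + powWeightedNorm ξ1 p1 u1 ≤ C := by
  have hp0' : 0 < p0 := by linarith
  have hp1' : 0 < p1 := by linarith
  have hdpos : 0 < ξ1 / p0 - ξ0 / p1 := by
    have h1 : 0 < ξ1 / p0 := by positivity
    have h2 : ξ0 / p1 < 0 := div_neg_of_neg_of_pos hξ0 hp1'
    linarith
  set d := ξ1 / p0 - ξ0 / p1 with hd
  let J0 : ℝ≥0∞ := ENNReal.ofReal d⁻¹ * ENNReal.ofReal (1 / p)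
  have hJ0 : J0 ≠ ⊤ := ENNReal.mul_ne_top ENNReal.ofReal_ne_top ENNReal.ofReal_ne_top
  refine ⟨(ENNReal.ofReal (Real.exp |ξ0|) ^ p0 * (2 ^ p0 * (J0 + 1))) ^ (1 / p0) +
    (ENNReal.ofReal (Real.exp |ξ1|) ^ p1 * (2 ^ p1 * (J0 + 1))) ^ (1 / p1), ?_, ?_⟩
  · have gen : ∀ ξ q : ℝ, 0 < q →
      (ENNReal.ofReal (Real.exp |ξ|) ^ q * (2 ^ q * (J0 + 1))) ^ (1 / q) ≠ ⊤ := by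
      intro ξ q hq
      refine ENNReal.rpow_ne_top_of_nonneg (by positivity) (ENNReal.mul_ne_top ?_
        (ENNReal.mul_ne_top ?_ (ENNReal.add_ne_top.2 ⟨hJ0, by simp⟩)))
      · exact ENNReal.rpow_ne_top_of_nonneg hq.le (by simp)
      · exact ENNReal.rpow_ne_top_of_nonneg hq.le (by simp)
    exact ENNReal.add_ne_top.2 ⟨gen _ _ hp0', gen _ _ hp1'⟩
  intro x ⟨y', z', hx'⟩ hN
  have hkt : ∀ σ, Kfun i0 i1 (Real.exp σ) x ≠ ⊤ := fun σ =>
    ne_top_of_le_ne_top ENNReal.ofReal_ne_top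
      (Kfun_le i0 i1 x _ _ hx' (Real.exp σ) (Real.exp_pos _).le)
  have hcore := core_identity ξ0 ξ1 p0 p1 θ p hξ0 hξ1 hp0 hp1 hp hθ hpp
    (fun σ => Kfun i0 i1 (Real.exp σ) x) (Kfun_meas i0 i1 x) hkt
  rw [interp_log] at hN
  set I := ∫⁻ σ : ℝ, (ENNReal.ofReal (Real.exp (-θ * σ)) * Kfun i0 i1 (Real.exp σ) x) ^ p with hI
  have hI1 : I ≤ 1 := by
    have h1 := ENNReal.rpow_le_one hN hp.le
    rwa [← ENNReal.rpow_mul, one_div_mul_cancel hp.ne', ENNReal.rpow_one] at h1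
  set k : ℝ → ℝ≥0∞ := fun σ => Kfun i0 i1 (Real.exp σ) x with hk
  set f : ℝ → ℝ≥0∞ := fun τ => ∫⁻ ρ : ℝ, Gfun ξ0 ξ1 p0 p1 k τ ρ with hf
  have hfm : Measurable f :=
    (Gfun_meas ξ0 ξ1 p0 p1 k (Kfun_meas i0 i1 x)).lintegral_prod_right'
  have hJ : ∫⁻ τ, f τ ≤ J0 := by
    have e : ∫⁻ τ, f τ = ENNReal.ofReal d⁻¹ * (ENNReal.ofReal d * ∫⁻ τ, f τ) := by
      rw [← mul_assoc, ← ENNReal.ofReal_mul (by positivity), inv_mul_cancel₀ hdpos.ne',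
        ENNReal.ofReal_one, one_mul]
    rw [e, ← hcore]
    exact mul_le_mul_right (mul_le_of_le_one_right' hI1) _
  have hT : ∀ n : ℤ, ∃ τ ∈ Ico (n:ℝ) (n + 1), f τ ≤ ∫⁻ τ in Ico (n:ℝ) (n + 1), f τ := by
    intro n
    obtain ⟨τ, hτ, h⟩ := exists_le_setLAverage (μ := volume) (s := Ico (n:ℝ) (n + 1)) (f := f)
      (by simp) (by simp) hfm.aemeasurable
    refine ⟨τ, hτ, h.trans ?_⟩
    rw [setLAverage_eq]
    simp
  choose T hTm hTf using hT
  have hsum : ∑' n, f (T n) ≤ J0 := by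
    refine (ENNReal.tsum_le_tsum hTf).trans ?_
    rw [← lintegral_iUnion (fun _ => measurableSet_Ico) (pairwise_disjoint_Ico_intCast ℝ),
      iUnion_Ico_intCast ℝ, setLIntegral_univ]
    exact hJ
  obtain ⟨ε, hεpos, hεsum⟩ := ENNReal.exists_pos_sum_of_countable one_ne_zero ℤ
  have hft : ∀ n, f (T n) ≠ ⊤ := fun n =>
    ne_top_of_le_ne_top hJ0 ((ENNReal.le_tsum n).trans hsum)
  let M : ℤ → ℝ≥0∞ := fun n => f (T n) + ε n
  have hMsum : ∑' n, M n ≤ J0 + 1 := by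
    rw [ENNReal.tsum_add]
    exact add_le_add hsum hεsum.le
  have hdec : ∀ n : ℤ, ∃ (y : X0) (z : X1), x = i0 y + i1 z ∧
      (ENNReal.ofReal (Real.exp (T n) ^ ξ0) * (‖y‖₊ : ℝ≥0∞)) ^ p0 ≤ 2 ^ p0 * M n ∧
      (ENNReal.ofReal (Real.exp (T n) ^ ξ1) * (‖z‖₊ : ℝ≥0∞)) ^ p1 ≤ 2 ^ p1 * M n := by
    intro n
    have hMt : M n ≠ ⊤ := ENNReal.add_ne_top.2 ⟨hft n, by simp⟩
    have hlt : f (T n) < M n := ENNReal.lt_add_right (hft n) (by simpa using (hεpos n).ne')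
    have hρ : ∃ ρ : ℝ, ENNReal.ofReal (Real.exp ρ) < M n ∧
        k ((ξ1 - ξ0) * T n + (p0⁻¹ - p1⁻¹) * ρ) ≤
          ENNReal.ofReal (Real.exp (-ξ0 * T n + p0⁻¹ * ρ)) := by
      by_contra hcon
      push Not at hcon
      have h1 := lint_exp_lt (M n) hMt 1 one_pos
      simp only [one_mul, div_one, ENNReal.ofReal_one, ENNReal.rpow_one] at h1
      refine absurd hlt (not_lt.2 ?_)
      rw [← h1]
      refine lintegral_mono fun ρ => ?_
      simp only [Gfun]
      by_cases h2 : ENNReal.ofReal (Real.exp ρ) < M n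
      · rw [if_pos h2, if_pos (hcon ρ h2)]
      · rw [if_neg h2]; exact bot_le
    obtain ⟨ρ, hρM, hρk⟩ := hρ
    obtain ⟨y, z, hxyz, hy, hz⟩ := Kfun_exists i0 i1 x _ _ (Real.exp_pos _).le (Real.exp_pos _) hρk
    refine ⟨y, z, hxyz, ?_, ?_⟩
    · refine (weight_two ξ0 p0 (T n) ρ hp0 y ?_).trans (mul_le_mul_right hρM.le _)
      refine hy.trans (le_of_eq ?_)
      congr 2; ring
    · refine (weight_two ξ1 p1 (T n) ρ hp1 z ?_).trans (mul_le_mul_right hρM.le _)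
      have h6 : Real.exp (-ξ0 * T n + p0⁻¹ * ρ) = Real.exp ((ξ1 - ξ0) * T n + (p0⁻¹ - p1⁻¹) * ρ) *
          Real.exp (p1⁻¹ * ρ - ξ1 * T n) := by
        rw [← Real.exp_add]; congr 1; ring
      rw [h6, mul_left_comm] at hz
      exact le_of_mul_le_mul_left hz (Real.exp_pos _)
  choose y z hxyz hy hz using hdec
  refine ⟨fun t => y ⌊Real.log t⌋, fun t => z ⌊Real.log t⌋, ?_, ?_, ?_, ?_⟩
  · exact (StronglyMeasurable.of_discrete.comp_measurable
      (Int.measurable_floor.comp Real.measurable_log)).aestronglyMeasurable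
  · exact (StronglyMeasurable.of_discrete.comp_measurable
      (Int.measurable_floor.comp Real.measurable_log)).aestronglyMeasurable
  · exact Eventually.of_forall fun t => hxyz _
  · refine add_le_add ((step_bound ξ0 p0 hp0 y T hTm M hy).trans ?_)
      ((step_bound ξ1 p1 hp1 z T hTm M hz).trans ?_) <;>
    gcongr

lemma Kfun_smul (t l : ℝ) (hl : 0 < l) (x : V) :
    Kfun i0 i1 t (l • x) ≤ ENNReal.ofReal l * Kfun i0 i1 t x := by
  have hl' : ENNReal.ofReal l ≠ 0 := by simpa using hl
  rw [mul_comm, ← ENNReal.div_le_iff_le_mul (Or.inl hl') (Or.inl ENNReal.ofReal_ne_top)]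
  refine le_iInf fun y => le_iInf fun z => le_iInf fun hx => ?_
  refine ENNReal.div_le_of_le_mul ?_
  refine (iInf_le_of_le (l • y) (iInf_le_of_le (l • z) (iInf_le_of_le ?_ le_rfl))).trans ?_
  · rw [hx, map_smul, map_smul, smul_add]
  · have e : ∀ {W : Type _} [NormedAddCommGroup W] [NormedSpace ℝ W] (w : W),
        (‖l • w‖₊ : ℝ≥0∞) = ENNReal.ofReal l * ‖w‖₊ := by
      intro W _ _ w
      rw [nnnorm_smul, ENNReal.coe_mul, ← ENNReal.ofReal_coe_nnreal (p := ‖l‖₊), coe_nnnorm,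
        Real.norm_of_nonneg hl.le]
    have e2 : (‖l • z‖₊ : ℝ≥0∞) = ENNReal.ofReal l * ‖z‖₊ := by
      rw [nnnorm_smul, ENNReal.coe_mul, ← ENNReal.ofReal_coe_nnreal (p := ‖l‖₊), coe_nnnorm,
        Real.norm_of_nonneg hl.le]
    rw [e, e2]
    refine le_of_eq ?_
    ring

lemma interp_smul (θ p l : ℝ) (hp : 0 < p) (hl : 0 < l) (x : V) :
    interpNorm i0 i1 θ p (l • x) ≤ ENNReal.ofReal l * interpNorm i0 i1 θ p x := by
  rw [interp_log, interp_log]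
  have e : ENNReal.ofReal l = (ENNReal.ofReal l ^ p) ^ (1 / p) := by
    rw [← ENNReal.rpow_mul, mul_one_div_cancel hp.ne', ENNReal.rpow_one]
  rw [e, ← ENNReal.mul_rpow_of_nonneg _ _ (by positivity)]
  refine ENNReal.rpow_le_rpow ?_ (by positivity)
  rw [← lintegral_const_mul' _ _ (ENNReal.rpow_ne_top_of_nonneg hp.le ENNReal.ofReal_ne_top)]
  refine lintegral_mono fun σ => ?_
  simp only
  rw [← ENNReal.mul_rpow_of_nonneg _ _ hp.le]
  refine ENNReal.rpow_le_rpow ?_ hp.le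
  rw [mul_left_comm]
  exact mul_le_mul_right (Kfun_smul i0 i1 _ l hl x) _

lemma powW_smul {W : Type*} [NormedAddCommGroup W] [NormedSpace ℝ W] (ξ q l : ℝ) (hq : 0 < q)
    (hl : 0 < l) (u : ℝ → W) :
    powWeightedNorm ξ q (fun t => l • u t) = ENNReal.ofReal l * powWeightedNorm ξ q u := by
  rw [powW_log, powW_log]
  have e : ENNReal.ofReal l = (ENNReal.ofReal l ^ q) ^ (1 / q) := by
    rw [← ENNReal.rpow_mul, mul_one_div_cancel hq.ne', ENNReal.rpow_one]
  rw [e, ← ENNReal.mul_rpow_of_nonneg _ _ (by positivity),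
    ← lintegral_const_mul' _ _ (ENNReal.rpow_ne_top_of_nonneg hq.le ENNReal.ofReal_ne_top)]
  congr 1
  refine lintegral_congr fun τ => ?_
  rw [← ENNReal.mul_rpow_of_nonneg _ _ hq.le, nnnorm_smul, ENNReal.coe_mul,
    ← ENNReal.ofReal_coe_nnreal (p := ‖l‖₊), coe_nnnorm, Real.norm_of_nonneg hl.le]
  congr 1
  ring

lemma interp_top (θ p : ℝ) (hp : 0 < p) (x : V) (hx : ¬ ∃ (y : X0) (z : X1), x = i0 y + i1 z) :
    interpNorm i0 i1 θ p x = ⊤ := by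
  have hK : ∀ t, Kfun i0 i1 t x = ⊤ := by
    intro t
    unfold Kfun
    simp only [iInf_eq_top]
    intro y z h
    exact absurd ⟨y, z, h⟩ hx
  rw [interp_log]
  have : ∀ σ : ℝ, (ENNReal.ofReal (Real.exp (-θ * σ)) * Kfun i0 i1 (Real.exp σ) x) ^ p = ⊤ := by
    intro σ
    rw [hK, ENNReal.mul_top (by simp [Real.exp_pos]), ENNReal.top_rpow_of_pos hp]
  simp only [this]
  rw [lintegral_const, Real.volume_univ, ENNReal.top_mul_top, ENNReal.top_rpow_of_pos (by positivity)]

lemma lemA' (ξ0 ξ1 p0 p1 θ p : ℝ) (hξ0 : ξ0 < 0) (hξ1 : 0 < ξ1)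
    (hp0 : 1 ≤ p0) (hp1 : 1 ≤ p1) (hp : 0 < p)
    (hθ : θ = ξ0 / (ξ0 - ξ1)) (hpp : 1 / p = (1 - θ) / p0 + θ / p1) :
    ∃ C : ℝ≥0∞, C ≠ 0 ∧ C ≠ ⊤ ∧ ∀ (x : V) (u0 : ℝ → X0) (u1 : ℝ → X1),
      AEStronglyMeasurable u0 (volume.restrict (Ioi (0:ℝ))) →
      (∀ᵐ t ∂(volume.restrict (Ioi (0:ℝ))), x = i0 (u0 t) + i1 (u1 t)) →
      interpNorm i0 i1 θ p x ≤ C * (powWeightedNorm ξ0 p0 u0 + powWeightedNorm ξ1 p1 u1) := by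
  have hp0' : 0 < p0 := by linarith
  have hp1' : 0 < p1 := by linarith
  obtain ⟨C, hC, h⟩ := lemA i0 i1 ξ0 ξ1 p0 p1 θ p hξ0 hξ1 hp0 hp1 hp hθ hpp
  have hC0 : C + 1 ≠ 0 := by simp
  have hCt : C + 1 ≠ ⊤ := ENNReal.add_ne_top.2 ⟨hC, by simp⟩
  refine ⟨C + 1, hC0, hCt, ?_⟩
  intro x u0 u1 hm hae
  set S := powWeightedNorm ξ0 p0 u0 + powWeightedNorm ξ1 p1 u1 with hS
  by_cases hSt : S = ⊤
  · rw [hSt, ENNReal.mul_top hC0]; exact le_top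
  have key : ∀ l : ℝ, 0 < l → S ≤ ENNReal.ofReal l →
      interpNorm i0 i1 θ p x ≤ ENNReal.ofReal l * C := by
    intro l hl hSl
    have hli : 0 < l⁻¹ := inv_pos.2 hl
    have hmul : ENNReal.ofReal l⁻¹ * ENNReal.ofReal l = 1 := by
      rw [← ENNReal.ofReal_mul hli.le, inv_mul_cancel₀ hl.ne', ENNReal.ofReal_one]
    have h1 := h (l⁻¹ • x) (fun t => l⁻¹ • u0 t) (fun t => l⁻¹ • u1 t) (hm.const_smul l⁻¹)
      (by
        filter_upwards [hae] with t ht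
        rw [map_smul, map_smul, ← smul_add, ← ht])
      (by
        rw [powW_smul _ _ _ hp0' hli, ← hmul]
        exact mul_le_mul_right (le_self_add.trans hSl) _)
      (by
        rw [powW_smul _ _ _ hp1' hli, ← hmul]
        exact mul_le_mul_right (le_add_self.trans hSl) _)
    have h2 := interp_smul i0 i1 θ p l hp hl (l⁻¹ • x)
    rw [smul_smul, mul_inv_cancel₀ hl.ne', one_smul] at h2
    exact h2.trans (mul_le_mul_right h1 _)
  rw [mul_comm, ← ENNReal.div_le_iff_le_mul (Or.inl hC0) (Or.inl hCt)]
  refine ENNReal.le_of_forall_pos_le_add ?_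
  intro ε hε _
  refine ENNReal.div_le_of_le_mul ?_
  have hle : ENNReal.ofReal (S.toReal + ε) = S + ε := by
    rw [ENNReal.ofReal_add (by positivity) (by positivity), ENNReal.ofReal_toReal hSt,
      ENNReal.ofReal_coe_nnreal]
  have h3 := key (S.toReal + ε) (by positivity) (by rw [hle]; exact le_self_add)
  rw [hle] at h3
  exact h3.trans (mul_le_mul_right le_self_add _)

lemma lemB' (ξ0 ξ1 p0 p1 θ p : ℝ) (hξ0 : ξ0 < 0) (hξ1 : 0 < ξ1)
    (hp0 : 1 ≤ p0) (hp1 : 1 ≤ p1) (hp : 0 < p)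
    (hθ : θ = ξ0 / (ξ0 - ξ1)) (hpp : 1 / p = (1 - θ) / p0 + θ / p1) :
    ∃ C : ℝ≥0∞, C ≠ 0 ∧ C ≠ ⊤ ∧ ∀ (x : V), (∃ (y : X0) (z : X1), x = i0 y + i1 z) →
      ∀ l : ℝ, 0 < l → interpNorm i0 i1 θ p x ≤ ENNReal.ofReal l →
      ∃ (u0 : ℝ → X0) (u1 : ℝ → X1),
      AEStronglyMeasurable u0 (volume.restrict (Ioi (0:ℝ))) ∧
      AEStronglyMeasurable u1 (volume.restrict (Ioi (0:ℝ))) ∧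
      (∀ᵐ t ∂(volume.restrict (Ioi (0:ℝ))), x = i0 (u0 t) + i1 (u1 t)) ∧
      powWeightedNorm ξ0 p0 u0 + powWeightedNorm ξ1 p1 u1 ≤ C * ENNReal.ofReal l := by
  have hp0' : 0 < p0 := by linarith
  have hp1' : 0 < p1 := by linarith
  obtain ⟨C, hC, h⟩ := lemB i0 i1 ξ0 ξ1 p0 p1 θ p hξ0 hξ1 hp0 hp1 hp hθ hpp
  refine ⟨C + 1, by simp, ENNReal.add_ne_top.2 ⟨hC, by simp⟩, ?_⟩
  rintro x ⟨y, z, hx⟩ l hl hN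
  have hli : 0 < l⁻¹ := inv_pos.2 hl
  have hmul : ENNReal.ofReal l⁻¹ * ENNReal.ofReal l = 1 := by
    rw [← ENNReal.ofReal_mul hli.le, inv_mul_cancel₀ hl.ne', ENNReal.ofReal_one]
  obtain ⟨u0, u1, h0, h1, hae, hle⟩ := h (l⁻¹ • x)
    ⟨l⁻¹ • y, l⁻¹ • z, by rw [hx, map_smul, map_smul, smul_add]⟩
    ((interp_smul i0 i1 θ p l⁻¹ hp hli x).trans (by
      rw [← hmul]; exact mul_le_mul_right hN _))
  refine ⟨fun t => l • u0 t, fun t => l • u1 t, h0.const_smul l, h1.const_smul l, ?_, ?_⟩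
  · filter_upwards [hae] with t ht
    rw [map_smul, map_smul, ← smul_add, ← ht, smul_smul, mul_inv_cancel₀ hl.ne', one_smul]
  · rw [powW_smul _ _ _ hp0' hl, powW_smul _ _ _ hp1' hl, ← mul_add, mul_comm]
    exact mul_le_mul_left (hle.trans le_self_add) _

end Kf

/-- **The first mean method.** Let `(X0,X1)` be an interpolation couple, `ξ0 < 0 < ξ1`,
`1 ≤ p0, p1 < ∞`, `θ = ξ0/(ξ0-ξ1)` and `1/p = (1-θ)/p0 + θ/p1`. Then `x ∈ (X0,X1)_{θ,p}`
iff there are measurable `u_j : (0,∞) → X_j` with `t ↦ t^{ξ_j} u_j(t) ∈ L^{p_j}(dt/t; X_j)`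
and `x = u_0(t) + u_1(t)` a.e.; moreover the interpolation norm is equivalent to the
infimum of `∑_j ‖t ↦ t^{ξ_j}u_j(t)‖_{L^{p_j}(dt/t;X_j)}` over all such decompositions. -/
theorem mean_method_characterization
    [NormedAddCommGroup X0] [NormedSpace ℝ X0] [CompleteSpace X0]
    [NormedAddCommGroup X1] [NormedSpace ℝ X1] [CompleteSpace X1]
    [AddCommGroup V] [Module ℝ V] [TopologicalSpace V] [T2Space V]
    (i0 : X0 →ₗ[ℝ] V) (i1 : X1 →ₗ[ℝ] V)
    (hi0 : Continuous i0) (hi1 : Continuous i1)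
    (hinj0 : Function.Injective i0) (hinj1 : Function.Injective i1)
    (ξ0 ξ1 p0 p1 θ p : ℝ) (hξ0 : ξ0 < 0) (hξ1 : 0 < ξ1)
    (hp0 : 1 ≤ p0) (hp1 : 1 ≤ p1)
    (hθ : θ = ξ0 / (ξ0 - ξ1)) (hp : 1 / p = (1 - θ) / p0 + θ / p1) :
    ∃ c C : ℝ≥0∞, 0 < c ∧ C ≠ ⊤ ∧ ∀ x : V,
      (((∃ (y : X0) (z : X1), x = i0 y + i1 z) ∧ interpNorm i0 i1 θ p x < ⊤) ↔
        (∃ (u0 : ℝ → X0) (u1 : ℝ → X1),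
          AEStronglyMeasurable u0 (volume.restrict (Ioi (0:ℝ))) ∧
          AEStronglyMeasurable u1 (volume.restrict (Ioi (0:ℝ))) ∧
          powWeightedNorm ξ0 p0 u0 < ⊤ ∧ powWeightedNorm ξ1 p1 u1 < ⊤ ∧
          ∀ᵐ t ∂(volume.restrict (Ioi (0:ℝ))), x = i0 (u0 t) + i1 (u1 t)))
      ∧ c * interpNorm i0 i1 θ p x ≤
          (⨅ (u : (ℝ → X0) × (ℝ → X1))
            (_ : AEStronglyMeasurable u.1 (volume.restrict (Ioi (0:ℝ))) ∧
                 AEStronglyMeasurable u.2 (volume.restrict (Ioi (0:ℝ))) ∧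
                 ∀ᵐ t ∂(volume.restrict (Ioi (0:ℝ))), x = i0 (u.1 t) + i1 (u.2 t)),
            powWeightedNorm ξ0 p0 u.1 + powWeightedNorm ξ1 p1 u.2)
      ∧ (⨅ (u : (ℝ → X0) × (ℝ → X1))
            (_ : AEStronglyMeasurable u.1 (volume.restrict (Ioi (0:ℝ))) ∧
                 AEStronglyMeasurable u.2 (volume.restrict (Ioi (0:ℝ))) ∧
                 ∀ᵐ t ∂(volume.restrict (Ioi (0:ℝ))), x = i0 (u.1 t) + i1 (u.2 t)),
            powWeightedNorm ξ0 p0 u.1 + powWeightedNorm ξ1 p1 u.2)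
          ≤ C * interpNorm i0 i1 θ p x := by
  have hp0' : 0 < p0 := by linarith
  have hp1' : 0 < p1 := by linarith
  have hθ0 : 0 < θ := by rw [hθ]; exact div_pos_of_neg_of_neg hξ0 (by linarith)
  have hθ1 : θ < 1 := by
    rw [hθ, div_lt_one_of_neg (by linarith)]; linarith
  have hpp : 0 < p := by
    have h1 : 0 < 1 / p := by
      rw [hp]
      have h2 : 0 < (1 - θ) / p0 := div_pos (by linarith) hp0'
      have h3 : 0 < θ / p1 := div_pos hθ0 hp1'
      linarith
    exact one_div_pos.1 h1
  obtain ⟨CA, hCA0, hCAt, hA⟩ :=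
    lemA' i0 i1 ξ0 ξ1 p0 p1 θ p hξ0 hξ1 hp0 hp1 hpp hθ hp
  obtain ⟨CB, hCB0, hCBt, hB⟩ :=
    lemB' i0 i1 ξ0 ξ1 p0 p1 θ p hξ0 hξ1 hp0 hp1 hpp hθ hp
  refine ⟨CA⁻¹, CB, ENNReal.inv_pos.2 hCAt, hCBt, fun x => ⟨⟨?_, ?_⟩, ?_, ?_⟩⟩
  · rintro ⟨hx, hN⟩
    obtain ⟨l, hl⟩ := ENNReal.lt_iff_exists_nnreal_btwn.1 hN
    have hl0 : (0:ℝ) < l := by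
      have : (0:ℝ≥0∞) < l := bot_le.trans_lt hl.1
      exact_mod_cast this
    obtain ⟨u0, u1, h0, h1, hae, hle⟩ := hB x hx l hl0
      (by rw [ENNReal.ofReal_coe_nnreal]; exact hl.1.le)
    have hlt := hle.trans_lt (ENNReal.mul_lt_top hCBt.lt_top ENNReal.ofReal_lt_top)
    have hlt' := ENNReal.add_lt_top.1 hlt
    exact ⟨u0, u1, h0, h1, hlt'.1, hlt'.2, hae⟩
  · rintro ⟨u0, u1, h0, h1, hP0, hP1, hae⟩
    obtain ⟨τ, hτ⟩ := (ae_exp hae).exists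
    exact ⟨⟨_, _, hτ⟩, (hA x u0 u1 h0 hae).trans_lt
      (ENNReal.mul_lt_top hCAt.lt_top (ENNReal.add_lt_top.2 ⟨hP0, hP1⟩))⟩
  · refine le_iInf fun u => le_iInf fun hu => ?_
    rw [mul_comm, ← div_eq_mul_inv]
    refine ENNReal.div_le_of_le_mul ?_
    rw [mul_comm]
    exact hA x u.1 u.2 hu.1 hu.2.2
  · by_cases hx : ∃ (y : X0) (z : X1), x = i0 y + i1 z
    · by_cases hN : interpNorm i0 i1 θ p x = ⊤
      · rw [hN, ENNReal.mul_top hCB0]; exact le_top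
      rw [mul_comm, ← ENNReal.div_le_iff_le_mul (Or.inl hCB0) (Or.inl hCBt)]
      refine ENNReal.le_of_forall_pos_le_add ?_
      intro ε hε _
      refine ENNReal.div_le_of_le_mul ?_
      have hl0 : (0:ℝ) < (interpNorm i0 i1 θ p x).toReal + ε := by positivity
      have hle : ENNReal.ofReal ((interpNorm i0 i1 θ p x).toReal + ε)
          = interpNorm i0 i1 θ p x + ε := by
        rw [ENNReal.ofReal_add (by positivity) (by positivity), ENNReal.ofReal_toReal hN,
          ENNReal.ofReal_coe_nnreal]
      obtain ⟨u0, u1, h0, h1, hae, hle2⟩ := hB x hx _ hl0 (by rw [hle]; exact le_self_add)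
      rw [hle, mul_comm] at hle2
      exact (iInf_le_of_le (u0, u1) (iInf_le_of_le ⟨h0, h1, hae⟩ le_rfl)).trans hle2
    · rw [interp_top i0 i1 θ p hpp x hx, ENNReal.mul_top hCB0]; exact le_top
end
end

section
/- Let $X$ be a Banach space, $p\in(1,\infty)$, $\gamma\in(-1,p-1)$, and let $\mathfrak{D}_T u = u'$ on $L^p((0,T),t^\gamma dt;X)$ with domain $\{u\in W^{1,p}((0,T),t^\gamma dt;X): u(0)=0\}$, $T\in(0,\infty]$. Then for every $\lambda\in\mathbb{C}$ with $\Re\lambda>0$, the resolvent is given by $(\lambda+\mathfrak{D}_T)^{-1}f(t)=\int_0^t e^{-\lambda(t-s)}f(s)\,ds$, and $\Re(\lambda)\,(\lambda+\mathfrak{D}_T)^{-1}$ is uniformly bounded on $L^p((0,T),t^\gamma dt;X)$. -/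
open MeasureTheory Set ENNReal Filter intervalIntegral

noncomputable section

variable {X : Type*} [NormedAddCommGroup X] [NormedSpace ℂ X]

/-- The weighted `L^p(I, t^γ dt; X)` (extended) norm. -/
def wLpNorm (I : Set ℝ) (p γ : ℝ) (f : ℝ → X) : ℝ≥0∞ :=
  (∫⁻ t in I, ENNReal.ofReal (t ^ γ) * ((‖f t‖₊ : ℝ≥0∞)) ^ p) ^ (1 / p)

/-- Membership of `u` in the domain `{u ∈ W^{1,p}(I, t^γ dt;X) : u(0) = 0}` of the
derivative operator `𝔇_T u = u'`, with weak derivative `v`: `u` is the indefinite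
integral of `v ∈ L^p(I, t^γ dt; X)` (which in particular encodes `u(0) = 0`). -/
def memDerivDom (I : Set ℝ) (p γ : ℝ) (u v : ℝ → X) : Prop :=
  (∀ t ∈ I, IntegrableOn v (Ioc (0:ℝ) t)) ∧
  AEStronglyMeasurable v (volume.restrict I) ∧
  wLpNorm I p γ v < ⊤ ∧ wLpNorm I p γ u < ⊤ ∧
  ∀ t ∈ I, u t = ∫ s in (0:ℝ)..t, v s

/-- The candidate resolvent `(λ + 𝔇_T)⁻¹ f (t) = ∫_0^t e^{-λ(t-s)} f(s) ds`. -/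
def resolventD (lam : ℂ) (f : ℝ → X) (t : ℝ) : X :=
  ∫ s in (0:ℝ)..t, Complex.exp (-lam * (t - s)) • f s

theorem aux_ker_t {a : ℝ} (ha : 0 < a) (s : ℝ) :
    ∫⁻ t in Ioi s, ENNReal.ofReal (a * Real.exp (-a * (t - s))) ≤ 1 := by
  have h1 : ∀ t, a * Real.exp (-a * (t - s)) = (a * Real.exp (a * s)) * Real.exp (-a * t) := by
    intro t; rw [mul_assoc, ← Real.exp_add]; ring_nf
  have hi : IntegrableOn (fun t => a * Real.exp (-a * (t - s))) (Ioi s) := by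
    simp_rw [h1]
    exact (integrableOn_exp_mul_Ioi (by linarith : -a < 0) s).const_mul _
  rw [← ofReal_integral_eq_lintegral_ofReal hi (Eventually.of_forall fun t => by positivity)]
  apply ENNReal.ofReal_le_one.2
  simp_rw [h1]
  rw [MeasureTheory.integral_const_mul, integral_exp_mul_Ioi (by linarith)]
  have : Real.exp (a * s) * Real.exp (-a * s) = 1 := by
    rw [← Real.exp_add]; simp
  rw [neg_mul] at this ⊢
  field_simp
  linarith

theorem aux_ker_s {a : ℝ} (ha : 0 < a) (t : ℝ) :
    ∫⁻ s in Ioc 0 t, ENNReal.ofReal (a * Real.exp (-a * (t - s))) ≤ 1 := by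
  have h1 : ∀ s, a * Real.exp (-a * (t - s)) = (a * Real.exp (-a * t)) * Real.exp (a * s) := by
    intro t; rw [mul_assoc, ← Real.exp_add]; ring_nf
  have hi : IntegrableOn (fun s => a * Real.exp (-a * (t - s))) (Iic t) := by
    simp_rw [h1]
    exact (integrableOn_exp_mul_Iic ha t).const_mul _
  refine (lintegral_mono_set Ioc_subset_Iic_self).trans ?_
  rw [← ofReal_integral_eq_lintegral_ofReal hi (Eventually.of_forall fun t => by positivity)]
  apply ENNReal.ofReal_le_one.2
  simp_rw [h1]
  rw [MeasureTheory.integral_const_mul, integral_exp_mul_Iic ha]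
  have : Real.exp (a * t) * Real.exp (-a * t) = 1 := by
    rw [← Real.exp_add]; simp
  rw [neg_mul] at this ⊢
  field_simp
  linarith

theorem aux_ker_pt {a β s t : ℝ} (ha : 0 < a) (hβ0 : 0 ≤ β) (hβ1 : β < 1) (hs : 0 < s)
    (hst : s ≤ t) :
    a * Real.exp (-a * (t - s)) * s ^ (-β) ≤
      2 / t * s ^ (-β) + 2 * t ^ (-β) * (a * Real.exp (-a * (t - s))) := by
  have ht : 0 < t := hs.trans_le hst
  rcases le_total s (t / 2) with h | h
  · have h2 : a * Real.exp (-a * (t - s)) ≤ 2 / t := by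
      have h3 : a * (t - s) ≤ Real.exp (a * (t - s)) := by
        linarith [Real.add_one_le_exp (a * (t - s))]
      have h4 : a * Real.exp (-a * (t - s)) * (t - s) ≤ 1 := by
        rw [neg_mul, Real.exp_neg, mul_right_comm, mul_inv_le_iff₀ (Real.exp_pos _)]
        linarith
      rw [le_div_iff₀ ht]
      have : 0 < a * Real.exp (-a * (t - s)) := by positivity
      nlinarith
    have h5 := mul_le_mul_of_nonneg_right h2 (by positivity : 0 ≤ s ^ (-β))
    have : 0 ≤ 2 * t ^ (-β) * (a * Real.exp (-a * (t - s))) := by positivity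
    linarith
  · have h2 : s ^ (-β) ≤ 2 * t ^ (-β) := by
      calc s ^ (-β) ≤ (t / 2) ^ (-β) :=
            Real.rpow_le_rpow_of_nonpos (by positivity) h (by linarith)
        _ = 2 ^ β * t ^ (-β) := by
            rw [Real.div_rpow ht.le (by norm_num), Real.rpow_neg (by norm_num : (0:ℝ) ≤ 2)]
            field_simp
        _ ≤ 2 ^ (1:ℝ) * t ^ (-β) := by
            gcongr
            norm_num
        _ = _ := by simp
    have h5 := mul_le_mul_of_nonneg_right h2 (by positivity : 0 ≤ a * Real.exp (-a * (t - s)))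
    have : 0 ≤ 2 / t * s ^ (-β) := by positivity
    linarith

theorem aux_ker_w {a β t : ℝ} (ha : 0 < a) (hβ0 : 0 ≤ β) (hβ1 : β < 1) (ht : 0 < t) :
    ∫⁻ s in Ioc 0 t, ENNReal.ofReal (a * Real.exp (-a * (t - s)) * s ^ (-β)) ≤
      ENNReal.ofReal ((2 / (1 - β) + 2) * t ^ (-β)) := by
  have hβ : 0 < 1 - β := by linarith
  have hi : IntegrableOn (fun s : ℝ => 2 / t * s ^ (-β)) (Ioc 0 t) :=
    ((intervalIntegrable_iff_integrableOn_Ioc_of_le ht.le).1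
      (intervalIntegral.intervalIntegrable_rpow' (by linarith : -1 < -β))).const_mul _
  calc _ ≤ ∫⁻ s in Ioc 0 t, (ENNReal.ofReal (2 / t * s ^ (-β)) +
          ENNReal.ofReal (2 * t ^ (-β)) * ENNReal.ofReal (a * Real.exp (-a * (t - s)))) := by
        refine setLIntegral_mono' measurableSet_Ioc fun s hs => ?_
        have := hs.1
        rw [← ENNReal.ofReal_mul (by positivity), ← ENNReal.ofReal_add (by positivity) (by positivity)]
        exact ENNReal.ofReal_le_ofReal (aux_ker_pt ha hβ0 hβ1 hs.1 hs.2)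
    _ = (∫⁻ s in Ioc 0 t, ENNReal.ofReal (2 / t * s ^ (-β))) + ENNReal.ofReal (2 * t ^ (-β)) *
          ∫⁻ s in Ioc 0 t, ENNReal.ofReal (a * Real.exp (-a * (t - s))) := by
        rw [lintegral_add_left (by fun_prop), lintegral_const_mul _ (by fun_prop)]
    _ ≤ ENNReal.ofReal (2 / (1 - β) * t ^ (-β)) + ENNReal.ofReal (2 * t ^ (-β)) * 1 := by
        gcongr
        · rw [← ofReal_integral_eq_lintegral_ofReal hi]
          · apply ENNReal.ofReal_le_ofReal
            rw [MeasureTheory.integral_const_mul, ← intervalIntegral.integral_of_le ht.le,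
              integral_rpow (Or.inl (by linarith)), Real.zero_rpow (by linarith),
              Real.rpow_add ht, Real.rpow_one, neg_add_eq_sub]
            apply le_of_eq
            field_simp
            ring
          · filter_upwards [ae_restrict_mem measurableSet_Ioc] with s hs
            have := hs.1
            simp only [Pi.zero_apply]
            positivity
        · exact aux_ker_s ha t
    _ = _ := by
        rw [mul_one, ← ENNReal.ofReal_add (by positivity) (by positivity)]
        congr 1; ring

theorem aux_holder {a p δ t : ℝ} (ha : 0 < a) (hp : 1 < p) (hδ0 : 0 ≤ δ) (hδ1 : δ < p - 1)
    (ht : 0 < t) {g : ℝ → ℝ≥0∞} (hg : AEMeasurable g (volume.restrict (Ioc 0 t))) :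
    (∫⁻ s in Ioc 0 t, ENNReal.ofReal (a * Real.exp (-a * (t - s))) * g s) ^ p ≤
      ENNReal.ofReal ((2 / (1 - δ / (p - 1)) + 2) ^ (p - 1) * t ^ (-δ)) *
        ∫⁻ s in Ioc 0 t, ENNReal.ofReal (a * Real.exp (-a * (t - s)) * s ^ δ) * g s ^ p := by
  have hp1 : 0 < p - 1 := by linarith
  have hp0 : 0 < p := by linarith
  set β := δ / (p - 1) with hβ
  have hβ0 : 0 ≤ β := by positivity
  have hβ1 : β < 1 := by rw [hβ, div_lt_one hp1]; exact hδ1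
  have hβδ : β * (p - 1) = δ := by rw [hβ]; field_simp
  have hc : 0 < 2 / (1 - β) + 2 := by
    have : 0 < 1 - β := by linarith
    positivity
  have h1 : ∫⁻ s in Ioc 0 t, ENNReal.ofReal (a * Real.exp (-a * (t - s))) * g s ≤
      (∫⁻ s in Ioc 0 t, ENNReal.ofReal (a * Real.exp (-a * (t - s)) * s ^ (-β))) ^ ((p - 1) / p) *
      (∫⁻ s in Ioc 0 t, ENNReal.ofReal (a * Real.exp (-a * (t - s)) * s ^ δ) * g s ^ p) ^ (1 / p) := by
    refine le_trans (le_of_eq ?_) (ENNReal.lintegral_mul_norm_pow_le (by fun_prop)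
      (by fun_prop) (by positivity) (by positivity) (by field_simp; ring))
    refine setLIntegral_congr_fun measurableSet_Ioc fun s hs => ?_
    have hs0 := hs.1
    have hk : 0 < a * Real.exp (-a * (t - s)) := by positivity
    rw [ENNReal.mul_rpow_of_nonneg _ _ (by positivity : 0 ≤ 1 / p), ← ENNReal.rpow_mul,
      mul_one_div_cancel hp0.ne', ENNReal.rpow_one, ← mul_assoc,
      ENNReal.ofReal_rpow_of_pos (by positivity), ENNReal.ofReal_rpow_of_pos (by positivity),
      ← ENNReal.ofReal_mul (by positivity)]
    congr 2
    rw [Real.mul_rpow hk.le (by positivity), Real.mul_rpow hk.le (by positivity),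
      mul_mul_mul_comm, ← Real.rpow_add hk, ← Real.rpow_mul hs0.le, ← Real.rpow_mul hs0.le,
      ← Real.rpow_add hs0]
    have e1 : (p - 1) / p + 1 / p = 1 := by field_simp; ring
    have e2 : -β * ((p - 1) / p) + δ * (1 / p) = 0 := by rw [← hβδ]; ring
    rw [e1, e2]; simp
  calc _ ≤ _ := ENNReal.rpow_le_rpow h1 hp0.le
    _ = (∫⁻ s in Ioc 0 t, ENNReal.ofReal (a * Real.exp (-a * (t - s)) * s ^ (-β))) ^ (p - 1) *
        ∫⁻ s in Ioc 0 t, ENNReal.ofReal (a * Real.exp (-a * (t - s)) * s ^ δ) * g s ^ p := by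
      rw [ENNReal.mul_rpow_of_nonneg _ _ hp0.le, ← ENNReal.rpow_mul, ← ENNReal.rpow_mul,
        div_mul_cancel₀ _ hp0.ne', div_mul_cancel₀ _ hp0.ne', ENNReal.rpow_one]
    _ ≤ (ENNReal.ofReal ((2 / (1 - β) + 2) * t ^ (-β))) ^ (p - 1) * _ := by
      gcongr
      exact aux_ker_w ha hβ0 hβ1 ht
    _ = _ := by
      rw [ENNReal.ofReal_rpow_of_pos (by positivity), Real.mul_rpow hc.le (by positivity),
        ← Real.rpow_mul ht.le, neg_mul, hβδ]

theorem aux_schur {a p γ : ℝ} (ha : 0 < a) (hp : 1 < p) (hγ : γ < p - 1)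
    {I : Set ℝ} (hIm : MeasurableSet I) (hI0 : ∀ t ∈ I, 0 < t) (hI : ∀ t ∈ I, Ioc 0 t ⊆ I)
    {g : ℝ → ℝ≥0∞} (hg : Measurable g) :
    ∫⁻ t in I, ENNReal.ofReal (t ^ γ) *
      (∫⁻ s in Ioc 0 t, ENNReal.ofReal (a * Real.exp (-a * (t - s))) * g s) ^ p ≤
    ENNReal.ofReal ((2 / (1 - max 0 γ / (p - 1)) + 2) ^ (p - 1)) *
      ∫⁻ t in I, ENNReal.ofReal (t ^ γ) * g t ^ p := by
  set δ := max 0 γ with hδ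
  have hδ0 : 0 ≤ δ := le_max_left _ _
  have hδγ : γ ≤ δ := le_max_right _ _
  have hδ1 : δ < p - 1 := max_lt (by linarith) hγ
  have hp1 : 0 < p - 1 := by linarith
  set c := (2 / (1 - δ / (p - 1)) + 2) ^ (p - 1) with hc
  have hc0 : 0 ≤ c := by
    have : δ / (p - 1) < 1 := by rwa [div_lt_one hp1]
    have : 0 < 1 - δ / (p - 1) := by linarith
    positivity
  let K : ℝ → ℝ → ℝ≥0∞ := fun t s => (Ici s).indicator
    (fun t => ENNReal.ofReal (t ^ (γ - δ)) * (ENNReal.ofReal (a * Real.exp (-a * (t - s)) * s ^ δ) * g s ^ p)) t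
  have hK : Measurable (Function.uncurry K) := by
    have : Function.uncurry K = {z : ℝ × ℝ | z.2 ≤ z.1}.indicator (fun z =>
        ENNReal.ofReal (z.1 ^ (γ - δ)) * (ENNReal.ofReal (a * Real.exp (-a * (z.1 - z.2)) * z.2 ^ δ) * g z.2 ^ p)) := by
      ext ⟨t, s⟩; simp [K, Function.uncurry, indicator]
    rw [this]
    exact Measurable.indicator (by fun_prop) (measurableSet_le measurable_snd measurable_fst)
  calc _ ≤ ∫⁻ t in I, ENNReal.ofReal c * ∫⁻ s in I, K t s := by
        refine setLIntegral_mono' hIm fun t ht => ?_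
        have ht0 := hI0 t ht
        have : ∫⁻ s in Ioc 0 t, ENNReal.ofReal (t ^ (γ - δ)) * (ENNReal.ofReal (a * Real.exp (-a * (t - s)) * s ^ δ) * g s ^ p) ≤ ∫⁻ s in I, K t s := by
          refine le_trans (le_of_eq ?_) (lintegral_mono_set (hI t ht))
          refine setLIntegral_congr_fun measurableSet_Ioc fun s hs => ?_
          simp [K, indicator, hs.2]
        refine le_trans ?_ (mul_le_mul_right this _)
        rw [lintegral_const_mul _ (by fun_prop), ← mul_assoc, ← ENNReal.ofReal_mul hc0]
        refine (mul_le_mul_right (aux_holder ha hp hδ0 hδ1 ht0 hg.aemeasurable) _).trans ?_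
        rw [← mul_assoc, ← ENNReal.ofReal_mul (by positivity)]
        apply le_of_eq
        congr 2
        rw [sub_eq_add_neg γ δ, Real.rpow_add ht0]; ring
    _ = ENNReal.ofReal c * ∫⁻ s in I, ∫⁻ t in I, K t s := by
        rw [lintegral_const_mul _ (by fun_prop), lintegral_lintegral_swap hK.aemeasurable]
    _ ≤ _ := by
        refine mul_le_mul_right ?_ _
        refine setLIntegral_mono' hIm fun s hs => ?_
        have hs0 := hI0 s hs
        calc ∫⁻ t in I, K t s ≤ ∫⁻ t, K t s := setLIntegral_le_lintegral _ _
          _ = ∫⁻ t in Ici s, ENNReal.ofReal (t ^ (γ - δ)) * (ENNReal.ofReal (a * Real.exp (-a * (t - s)) * s ^ δ) * g s ^ p) := by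
              rw [← lintegral_indicator measurableSet_Ici]
          _ = ∫⁻ t in Ioi s, ENNReal.ofReal (t ^ (γ - δ)) * (ENNReal.ofReal (a * Real.exp (-a * (t - s)) * s ^ δ) * g s ^ p) := 
              (setLIntegral_congr Ioi_ae_eq_Ici).symm
          _ ≤ ∫⁻ t in Ioi s, (ENNReal.ofReal (s ^ γ) * g s ^ p) * ENNReal.ofReal (a * Real.exp (-a * (t - s))) := by
              refine setLIntegral_mono' measurableSet_Ioi fun t ht => ?_
              have ht : s < t := ht
              have ht0 : 0 < t := hs0.trans ht
              rw [← mul_assoc, ← ENNReal.ofReal_mul (by positivity),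
                mul_right_comm (ENNReal.ofReal (s ^ γ)), ← ENNReal.ofReal_mul (by positivity)]
              gcongr ENNReal.ofReal ?_ * _
              calc t ^ (γ - δ) * (a * Real.exp (-a * (t - s)) * s ^ δ) ≤ s ^ (γ - δ) * (a * Real.exp (-a * (t - s)) * s ^ δ) := by
                    gcongr ?_ * _
                    exact Real.rpow_le_rpow_of_nonpos hs0 ht.le (by linarith)
                _ = _ := by
                    have : s ^ γ = s ^ (γ - δ) * s ^ δ := by rw [← Real.rpow_add hs0]; simp
                    rw [this]; ring
          _ ≤ (ENNReal.ofReal (s ^ γ) * g s ^ p) * 1 := by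
              rw [lintegral_const_mul _ (by fun_prop)]
              gcongr
              exact aux_ker_t ha s
          _ = _ := mul_one _

theorem aux_l1 {p γ : ℝ} (hp : 1 < p) (hγ : γ < p - 1)
    {t : ℝ} (ht : 0 < t)
    {g : ℝ → ℝ≥0∞} (hg : AEMeasurable g (volume.restrict (Ioc 0 t)))
    (hfin : ∫⁻ s in Ioc 0 t, ENNReal.ofReal (s ^ γ) * g s ^ p < ⊤) :
    ∫⁻ s in Ioc 0 t, g s < ⊤ := by
  set δ := max 0 γ with hδ
  have hδ0 : 0 ≤ δ := le_max_left _ _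
  have hδγ : γ ≤ δ := le_max_right _ _
  have hδ1 : δ < p - 1 := max_lt (by linarith) hγ
  have h1 := aux_holder one_pos hp hδ0 hδ1 ht hg
  have h2 : ∫⁻ s in Ioc 0 t, ENNReal.ofReal (1 * Real.exp (-1 * (t - s)) * s ^ δ) * g s ^ p
      ≤ ENNReal.ofReal (t ^ (δ - γ)) * ∫⁻ s in Ioc 0 t, ENNReal.ofReal (s ^ γ) * g s ^ p := by
    rw [← lintegral_const_mul' _ _ ENNReal.ofReal_ne_top]
    refine setLIntegral_mono' measurableSet_Ioc fun s hs => ?_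
    have hs0 := hs.1
    rw [← mul_assoc, ← ENNReal.ofReal_mul (by positivity)]
    gcongr ENNReal.ofReal ?_ * _
    have e1 : s ^ δ = s ^ (δ - γ) * s ^ γ := by rw [← Real.rpow_add hs0]; simp
    have e2 : s ^ (δ - γ) ≤ t ^ (δ - γ) := Real.rpow_le_rpow hs0.le hs.2 (by linarith)
    have e3 : Real.exp (-1 * (t - s)) ≤ 1 := Real.exp_le_one_iff.2 (by linarith [hs.2])
    calc _ ≤ 1 * 1 * s ^ δ := by gcongr
      _ = s ^ (δ - γ) * s ^ γ := by rw [e1]; ring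
      _ ≤ _ := by gcongr
  have h3 := h1.trans (mul_le_mul_right h2 _)
  have h4 : (∫⁻ s in Ioc 0 t, ENNReal.ofReal (1 * Real.exp (-1 * (t - s))) * g s) < ⊤ := by
    have := h3.trans_lt (ENNReal.mul_lt_top ENNReal.ofReal_lt_top (ENNReal.mul_lt_top ENNReal.ofReal_lt_top hfin))
    rw [ENNReal.rpow_lt_top_iff_of_pos (by linarith)] at this
    exact this
  have h5 : ∫⁻ s in Ioc 0 t, g s ≤ ENNReal.ofReal (Real.exp t) * (∫⁻ s in Ioc 0 t, ENNReal.ofReal (1 * Real.exp (-1 * (t - s))) * g s) := by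
    rw [← lintegral_const_mul' _ _ ENNReal.ofReal_ne_top]
    refine setLIntegral_mono' measurableSet_Ioc fun s hs => ?_
    rw [← mul_assoc, ← ENNReal.ofReal_mul (by positivity)]
    refine le_mul_of_one_le_left (zero_le) ?_
    rw [ENNReal.one_le_ofReal, one_mul, ← Real.exp_add]
    exact Real.one_le_exp (by linarith [hs.1])
  exact h5.trans_lt (ENNReal.mul_lt_top ENNReal.ofReal_lt_top h4)

theorem aux_ibp [CompleteSpace X] {φ φ' : ℝ → ℂ} (hφ : ∀ r, HasDerivAt φ (φ' r) r)
    (hφ' : Continuous φ') {h : ℝ → X} {t : ℝ} (ht : 0 ≤ t) (hh : IntegrableOn h (Ioc 0 t)) :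
    φ t • (∫ s in (0:ℝ)..t, h s) =
      (∫ r in (0:ℝ)..t, φ' r • ∫ s in (0:ℝ)..r, h s) + ∫ r in (0:ℝ)..t, φ r • h r := by
  have hφc : Continuous φ := continuous_iff_continuousAt.2 fun r => (hφ r).continuousAt
  let F : ℝ → ℝ → X := fun r s => (Iic r).indicator (fun s => φ' r • h s) s
  have hF : Function.uncurry F = {z : ℝ × ℝ | z.2 ≤ z.1}.indicator (fun z => φ' z.1 • h z.2) := by
    ext ⟨r, s⟩; simp [F, Function.uncurry, indicator]
  have hFi : Integrable (Function.uncurry F)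
      ((volume.restrict (Ioc 0 t)).prod (volume.restrict (Ioc 0 t))) := by
    rw [hF]
    refine Integrable.indicator (Integrable.smul_prod ?_ hh)
      (measurableSet_le measurable_snd measurable_fst)
    exact hφ'.integrableOn_Ioc
  have hsw := integral_integral_swap hFi
  have h1 : ∫ r in Ioc 0 t, ∫ s in Ioc 0 t, F r s = ∫ r in (0:ℝ)..t, φ' r • ∫ s in (0:ℝ)..r, h s := by
    rw [intervalIntegral.integral_of_le ht]
    refine setIntegral_congr_fun measurableSet_Ioc fun r hr => ?_
    simp only [F]
    rw [setIntegral_indicator measurableSet_Iic, MeasureTheory.integral_smul,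
      intervalIntegral.integral_of_le hr.1.le, Ioc_inter_Iic, min_eq_right hr.2]
  have h2 : ∫ s in Ioc 0 t, ∫ r in Ioc 0 t, F r s = ∫ s in (0:ℝ)..t, (φ t - φ s) • h s := by
    rw [intervalIntegral.integral_of_le ht]
    refine setIntegral_congr_fun measurableSet_Ioc fun s hs => ?_
    have : ∀ r, F r s = (Ici s).indicator (fun r => φ' r • h s) r := by
      intro r; simp [F, indicator]
    simp only [this]
    rw [setIntegral_indicator measurableSet_Ici, _root_.integral_smul_const]
    have e : Ioc 0 t ∩ Ici s = Icc s t := by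
      ext r; simp only [mem_inter_iff, mem_Ioc, mem_Ici, mem_Icc]
      have := hs.1
      constructor
      · rintro ⟨⟨_, h⟩, h'⟩; exact ⟨h', h⟩
      · rintro ⟨h', h⟩; exact ⟨⟨by linarith, h⟩, h'⟩
    rw [e, integral_Icc_eq_integral_Ioc, ← intervalIntegral.integral_of_le hs.2,
      intervalIntegral.integral_eq_sub_of_hasDerivAt (fun x _ => hφ x) (hφ'.intervalIntegrable _ _)]
  have hi : IntervalIntegrable h volume 0 t := (intervalIntegrable_iff_integrableOn_Ioc_of_le ht).2 hh
  rw [← h1, hsw, h2]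
  simp only [sub_smul]
  have hi2 : IntervalIntegrable (fun s => φ t • h s) volume 0 t := hi.smul _
  rw [intervalIntegral.integral_sub hi2 (hi.continuousOn_smul hφc.continuousOn),
    intervalIntegral.integral_smul]
  abel

theorem aux_res_eq (lam : ℂ) (f : ℝ → X) (t : ℝ) :
    resolventD lam f t =
      Complex.exp (-lam * t) • ∫ s in (0:ℝ)..t, Complex.exp (lam * s) • f s := by
  unfold resolventD
  rw [← intervalIntegral.integral_smul]
  congr 1
  ext s
  rw [smul_smul, ← Complex.exp_add]
  congr 2
  ring

theorem aux_hasDeriv (c : ℂ) (r : ℝ) :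
    HasDerivAt (fun r : ℝ => Complex.exp (c * r)) (c * Complex.exp (c * r)) r := by
  have h1 : HasDerivAt (fun r : ℝ => c * (r : ℂ)) c r := by
    simpa using (Complex.ofRealCLM.hasDerivAt (x := r)).const_mul c
  have := h1.cexp
  rwa [mul_comm] at this

theorem aux_int_exp {lam : ℂ} {f : ℝ → X} {t : ℝ} (hf : IntegrableOn f (Ioc 0 t)) :
    IntegrableOn (fun s : ℝ => Complex.exp (lam * s) • f s) (Ioc 0 t) := by
  rcases le_total 0 t with ht | ht
  · rw [← intervalIntegrable_iff_integrableOn_Ioc_of_le ht] at hf ⊢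
    exact hf.continuousOn_smul (by fun_prop)
  · simp [Ioc_eq_empty_of_le ht]

theorem aux_res_cont (lam : ℂ) {f : ℝ → X} {t : ℝ} (ht : 0 ≤ t) (hf : IntegrableOn f (Ioc 0 t)) :
    ContinuousOn (resolventD lam f) (Icc 0 t) := by
  have h1 : ContinuousOn (fun r => ∫ s in (0:ℝ)..r, Complex.exp (lam * s) • f s) (Icc 0 t) := by
    have := intervalIntegral.continuousOn_primitive_interval (a := 0) (b := t) (μ := volume)
      (f := fun s : ℝ => Complex.exp (lam * s) • f s) (by
        rw [uIcc_of_le ht, integrableOn_Icc_iff_integrableOn_Ioc]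
        exact aux_int_exp hf)
    rwa [uIcc_of_le ht] at this
  have : resolventD lam f = fun t : ℝ =>
      Complex.exp (-lam * t) • ∫ s in (0:ℝ)..t, Complex.exp (lam * s) • f s :=
    funext fun t => aux_res_eq lam f t
  rw [this]
  exact ContinuousOn.smul (by fun_prop) h1

theorem aux_res_solve [CompleteSpace X] (lam : ℂ) {f : ℝ → X} {t : ℝ} (ht : 0 ≤ t)
    (hf : IntegrableOn f (Ioc 0 t)) :
    resolventD lam f t = ∫ s in (0:ℝ)..t, (f s - lam • resolventD lam f s) := by
  have hi : IntervalIntegrable f volume 0 t := (intervalIntegrable_iff_integrableOn_Ioc_of_le ht).2 hf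
  have hu : IntervalIntegrable (resolventD lam f) volume 0 t :=
    ContinuousOn.intervalIntegrable (by rw [uIcc_of_le ht]; exact aux_res_cont lam ht hf)
  have := aux_ibp (aux_hasDeriv (-lam)) (by fun_prop) ht (aux_int_exp (lam := lam) hf)
  have hu2 : IntervalIntegrable (fun s => lam • resolventD lam f s) volume 0 t := hu.smul lam
  rw [aux_res_eq, this, intervalIntegral.integral_sub hi hu2, sub_eq_neg_add,
    ← intervalIntegral.integral_neg]
  congr 1
  · congr 1; ext r
    rw [aux_res_eq, mul_smul, neg_smul]
  · congr 1; ext r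
    rw [smul_smul, ← Complex.exp_add]; simp

theorem aux_unique [CompleteSpace X] (lam : ℂ) {f u v : ℝ → X} {t : ℝ} (ht : 0 ≤ t)
    (hv : IntegrableOn v (Ioc 0 t)) (hu : ∀ r ∈ Ioc 0 t, u r = ∫ s in (0:ℝ)..r, v s)
    (hut : u t = ∫ s in (0:ℝ)..t, v s)
    (h : ∀ᵐ r ∂(volume.restrict (Ioc 0 t)), lam • u r + v r = f r) :
    u t = resolventD lam f t := by
  have hi : IntervalIntegrable v volume 0 t := (intervalIntegrable_iff_integrableOn_Ioc_of_le ht).2 hv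
  have hc : ContinuousOn (fun r => ∫ s in (0:ℝ)..r, v s) (uIcc 0 t) :=
    intervalIntegral.continuousOn_primitive_interval (by
        rw [uIcc_of_le ht, integrableOn_Icc_iff_integrableOn_Ioc]
        exact hv)
  have := aux_ibp (aux_hasDeriv lam) (by fun_prop) ht hv
  have hc2 : IntervalIntegrable (fun r : ℝ => (lam * Complex.exp (lam * r)) •
      ∫ s in (0:ℝ)..r, v s) volume 0 t :=
    ContinuousOn.intervalIntegrable (ContinuousOn.smul (by fun_prop) hc)
  rw [← intervalIntegral.integral_add hc2 (hi.continuousOn_smul (by fun_prop))] at this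
  have e : ∫ r in (0:ℝ)..t, ((lam * Complex.exp (lam * r)) • (∫ s in (0:ℝ)..r, v s) +
      Complex.exp (lam * r) • v r) = ∫ r in (0:ℝ)..t, Complex.exp (lam * r) • f r := by
    rw [intervalIntegral.integral_of_le ht, intervalIntegral.integral_of_le ht]
    apply MeasureTheory.integral_congr_ae
    filter_upwards [h, ae_restrict_mem measurableSet_Ioc] with r hr hr'
    rw [← hr, hu r hr', mul_comm, mul_smul, smul_add]
  rw [aux_res_eq, ← e, ← this, smul_smul, ← Complex.exp_add, hut]
  simp

theorem aux_wfin {I : Set ℝ} {p γ : ℝ} (hp : 1 < p) (f : ℝ → X) :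
    wLpNorm I p γ f < ⊤ ↔ ∫⁻ t in I, ENNReal.ofReal (t ^ γ) * ‖f t‖ₑ ^ p < ⊤ := by
  unfold wLpNorm
  rw [ENNReal.rpow_lt_top_iff_of_pos (by positivity)]
  rfl

theorem aux_bound {a p γ : ℝ} {lam : ℂ} (hlam : lam.re = a) (ha : 0 < a) (hp : 1 < p)
    (hγ : γ < p - 1)
    {I : Set ℝ} (hIm : MeasurableSet I) (hI0 : ∀ t ∈ I, 0 < t) (hI : ∀ t ∈ I, Ioc 0 t ⊆ I)
    {f : ℝ → X} (hf : AEStronglyMeasurable f (volume.restrict I)) :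
    ENNReal.ofReal a * wLpNorm I p γ (resolventD lam f) ≤
      ENNReal.ofReal ((2 / (1 - max 0 γ / (p - 1)) + 2) ^ (p - 1)) ^ (1 / p) * wLpNorm I p γ f := by
  have hp0 : 0 < p := by linarith
  unfold wLpNorm
  rw [← ENNReal.mul_rpow_of_nonneg _ _ (by positivity : 0 ≤ 1 / p)]
  have e : ENNReal.ofReal a = (ENNReal.ofReal a ^ p) ^ (1 / p) := by
    rw [← ENNReal.rpow_mul, mul_one_div_cancel hp0.ne', ENNReal.rpow_one]
  rw [e, ← ENNReal.mul_rpow_of_nonneg _ _ (by positivity : 0 ≤ 1 / p)]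
  refine ENNReal.rpow_le_rpow ?_ (by positivity)
  rw [← lintegral_const_mul' _ _ (by finiteness)]
  have hfm : Measurable (fun s => ‖hf.mk f s‖ₑ) := hf.stronglyMeasurable_mk.enorm
  have hS := aux_schur ha hp hγ hIm hI0 hI hfm
  have hae := hf.ae_eq_mk
  refine le_trans ?_ (hS.trans (le_of_eq ?_))
  · refine setLIntegral_mono' hIm fun t ht => ?_
    rw [mul_left_comm, ← ENNReal.mul_rpow_of_nonneg _ _ hp0.le]
    gcongr
    have h1 : (‖resolventD lam f t‖₊ : ℝ≥0∞) ≤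
        ∫⁻ s in Ioc 0 t, ‖Complex.exp (-lam * (t - s)) • f s‖ₑ := by
      unfold resolventD
      rw [intervalIntegral.integral_of_le (hI0 t ht).le]
      exact enorm_integral_le_lintegral_enorm _
    refine (mul_le_mul_right h1 _).trans ?_
    rw [← lintegral_const_mul' _ _ ENNReal.ofReal_ne_top]
    refine lintegral_mono_ae ?_
    filter_upwards [ae_restrict_of_ae_restrict_of_subset (hI t ht) hae] with s hs
    rw [enorm_smul, ← mul_assoc, hs, ENNReal.ofReal_mul ha.le, ← ofReal_norm, Complex.norm_exp]
    simp [hlam]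
  · congr 1
    refine lintegral_congr_ae ?_
    filter_upwards [hae] with t ht
    rw [← ht]; rfl

/-- For `p ∈ (1,∞)`, `γ ∈ (-1, p-1)`, `T ∈ (0,∞]` and `Re λ > 0`, the resolvent of the
derivative operator `𝔇_T u = u'` on `L^p((0,T), t^γ dt; X)` with domain
`{u ∈ W^{1,p} : u(0)=0}` is given by `(λ+𝔇_T)⁻¹ f(t) = ∫_0^t e^{-λ(t-s)} f(s) ds`,
i.e. this function lies in the domain and solves `λ u + u' = f` (uniquely so), and
`Re λ · (λ+𝔇_T)⁻¹` is uniformly bounded on `L^p((0,T), t^γ dt; X)`. -/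
theorem derivative_resolvent_formula
    (p γ : ℝ) (hp : 1 < p) (hγ₁ : -1 < γ) (hγ₂ : γ < p - 1)
    (I : Set ℝ) (hI : I = Ioi (0:ℝ) ∨ ∃ T : ℝ, 0 < T ∧ I = Ioo (0:ℝ) T) :
    ∃ C : ℝ≥0∞, C ≠ ⊤ ∧ ∀ (lam : ℂ), 0 < lam.re →
      ∀ f : ℝ → X, AEStronglyMeasurable f (volume.restrict I) → wLpNorm I p γ f < ⊤ →
        (∃ v : ℝ → X, memDerivDom I p γ (resolventD lam f) v ∧
          ∀ᵐ t ∂(volume.restrict I), lam • resolventD lam f t + v t = f t) ∧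
        (∀ u v : ℝ → X, memDerivDom I p γ u v →
          (∀ᵐ t ∂(volume.restrict I), lam • u t + v t = f t) →
          ∀ᵐ t ∂(volume.restrict I), u t = resolventD lam f t) ∧
        ENNReal.ofReal lam.re * wLpNorm I p γ (resolventD lam f) ≤ C * wLpNorm I p γ f := by
  have hIo : IsOpen I := by
    rcases hI with rfl | ⟨T, _, rfl⟩
    · exact isOpen_Ioi
    · exact isOpen_Ioo
  have hI0 : ∀ t ∈ I, 0 < t := by
    rcases hI with rfl | ⟨T, _, rfl⟩
    · exact fun t ht => ht
    · exact fun t ht => ht.1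
  have hIs : ∀ t ∈ I, Ioc 0 t ⊆ I := by
    rcases hI with rfl | ⟨T, _, rfl⟩
    · exact fun t _ s hs => hs.1
    · exact fun t ht s hs => ⟨hs.1, hs.2.trans_lt ht.2⟩
  have hIn : ∀ t ∈ I, ∃ t' ∈ I, t < t' := by
    rcases hI with rfl | ⟨T, _, rfl⟩
    · exact fun t ht => ⟨t + 1, by have : 0 < t := ht; simp only [mem_Ioi]; linarith, by linarith⟩
    · intro t ht
      obtain ⟨t', h1, h2⟩ := exists_between ht.2
      exact ⟨t', ⟨ht.1.trans h1, h2⟩, h1⟩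
  have hIm := hIo.measurableSet
  have hp0 : 0 < p := by linarith
  have hC : ENNReal.ofReal ((2 / (1 - max 0 γ / (p - 1)) + 2) ^ (p - 1)) ^ (1 / p) ≠ ⊤ :=
    ENNReal.rpow_ne_top_of_nonneg (by positivity) ENNReal.ofReal_ne_top
  refine ⟨_, hC, fun lam hlam f hf hfw => ?_⟩
  have hB := aux_bound (lam := lam) rfl hlam hp hγ₂ hIm hI0 hIs hf
  have hfI : ∀ t ∈ I, IntegrableOn f (Ioc 0 t) := by
    intro t ht
    have hm := hf.mono_measure (Measure.restrict_mono (hIs t ht) le_rfl)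
    refine ⟨hm, ?_⟩
    refine aux_l1 hp hγ₂ (hI0 t ht) hm.enorm ?_
    exact (lintegral_mono_set (hIs t ht)).trans_lt ((aux_wfin hp f).1 hfw)
  have hRw : wLpNorm I p γ (resolventD lam f) < ⊤ := by
    by_contra h
    have h' : wLpNorm I p γ (resolventD lam f) = ⊤ := by simpa using h
    rw [h', ENNReal.mul_top (by simpa using hlam)] at hB
    exact (ENNReal.mul_lt_top hC.lt_top hfw).not_ge hB
  by_cases hX : CompleteSpace X
  swap
  · have hz : ∀ (h : ℝ → X) (t : ℝ), ∫ s in (0:ℝ)..t, h s = 0 := by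
      intro h t
      simp [intervalIntegral, integral_of_not_completeSpace hX]
    have hr : ∀ t, resolventD lam f t = 0 := fun t => hz _ _
    refine ⟨⟨f, ⟨hfI, hf, hfw, hRw, fun t _ => by rw [hr, hz]⟩, ?_⟩, ?_, hB⟩
    · simp [hr]
    · intro u v huv _
      filter_upwards [ae_restrict_mem hIm] with t ht
      rw [huv.2.2.2.2 t ht, hz, hr]
  have hRc : ContinuousOn (resolventD lam f) I := by
    intro t ht
    obtain ⟨t', ht', htt'⟩ := hIn t ht
    exact ((aux_res_cont lam (hI0 t' ht').le (hfI t' ht')).continuousAt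
      (Icc_mem_nhds (hI0 t ht) htt')).continuousWithinAt
  have hRm : AEStronglyMeasurable (resolventD lam f) (volume.restrict I) :=
    hRc.aestronglyMeasurable hIm
  refine ⟨⟨fun t => f t - lam • resolventD lam f t, ⟨?_, ?_, ?_, hRw, ?_⟩, ?_⟩, ?_, hB⟩
  · intro t ht
    refine (hfI t ht).sub (Integrable.smul lam ?_)
    exact (((aux_res_cont lam (hI0 t ht).le (hfI t ht)).integrableOn_Icc).mono_set Ioc_subset_Icc_self)
  · exact hf.sub (hRm.const_smul lam)
  · rw [aux_wfin hp] at hfw hRw ⊢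
    have hle : ∀ t, ENNReal.ofReal (t ^ γ) * ‖f t - lam • resolventD lam f t‖ₑ ^ p ≤
        2 ^ (p - 1) * (ENNReal.ofReal (t ^ γ) * ‖f t‖ₑ ^ p) +
        2 ^ (p - 1) * ‖lam‖ₑ ^ p * (ENNReal.ofReal (t ^ γ) * ‖resolventD lam f t‖ₑ ^ p) := by
      intro t
      calc _ ≤ ENNReal.ofReal (t ^ γ) * (‖f t‖ₑ + ‖lam‖ₑ * ‖resolventD lam f t‖ₑ) ^ p := by
            gcongr
            refine (enorm_sub_le).trans ?_
            rw [enorm_smul]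
        _ ≤ ENNReal.ofReal (t ^ γ) * (2 ^ (p - 1) * (‖f t‖ₑ ^ p +
              (‖lam‖ₑ * ‖resolventD lam f t‖ₑ) ^ p)) := by
            gcongr
            exact ENNReal.rpow_add_le_mul_rpow_add_rpow _ _ hp.le
        _ = _ := by
            rw [ENNReal.mul_rpow_of_nonneg _ _ hp0.le]; ring
    have h2 : (2:ℝ≥0∞) ^ (p - 1) < ⊤ := ENNReal.rpow_lt_top_of_nonneg (by linarith) (by simp)
    have h3 : ‖lam‖ₑ ^ p < ⊤ := ENNReal.rpow_lt_top_of_nonneg (by linarith) (by simp)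
    refine (lintegral_mono hle).trans_lt ?_
    rw [lintegral_add_left', lintegral_const_mul' _ _ h2.ne,
      lintegral_const_mul' _ _ (ENNReal.mul_lt_top h2 h3).ne]
    · exact ENNReal.add_lt_top.2 ⟨ENNReal.mul_lt_top h2 hfw,
        ENNReal.mul_lt_top (ENNReal.mul_lt_top h2 h3) hRw⟩
    · have := hf.enorm
      fun_prop
  · intro t ht
    exact aux_res_solve lam (hI0 t ht).le (hfI t ht)
  · exact Eventually.of_forall fun t => by simp
  · intro u v huv h
    filter_upwards [ae_restrict_mem hIm] with t ht
    exact aux_unique lam (hI0 t ht).le (huv.1 t ht)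
      (fun r hr => huv.2.2.2.2 r (hIs t ht hr)) (huv.2.2.2.2 t ht)
      (ae_restrict_of_ae_restrict_of_subset (hIs t ht) h)
end
end

section
/- Let $p\in(1,\infty)$, $\gamma\in(-1,p-1)$, and let $X$ be a Banach space. For $\lambda>0$ let $K_\lambda f(t)=\lambda\int_t^\infty e^{-\lambda(s-t)}f(s)\,ds$ (the integral operator with kernel $k_\lambda(t-s)=\lambda e^{(t-s)\lambda}\mathbf{1}_{t<s}$). Then $\sup_{\lambda>0}\|K_\lambda\|_{\mathscr{L}(L^p(\mathbb{R},|t|^\gamma dt;X))}<\infty$. -/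
open MeasureTheory Set ENNReal

noncomputable section

variable {X : Type*} [NormedAddCommGroup X] [NormedSpace ℝ X] [CompleteSpace X]

/-- The weighted `L^p(ℝ, |t|^γ dt; X)` (extended) norm. -/
def wLpNormR (p γ : ℝ) (f : ℝ → X) : ℝ≥0∞ :=
  (∫⁻ t : ℝ, ENNReal.ofReal (|t| ^ γ) * (‖f t‖₊ : ℝ≥0∞) ^ p) ^ (1 / p)

/-- The integral operator `K_λ f(t) = λ ∫_t^∞ e^{-λ(s-t)} f(s) ds`. -/
def Kop (lam : ℝ) (f : ℝ → X) (t : ℝ) : X :=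
  lam • ∫ s in Ioi t, Real.exp (-lam * (s - t)) • f s

lemma aux_even (G : ℝ → ℝ≥0∞) (hG : Measurable G) :
    ∫⁻ x : ℝ, G |x| ≤ 2 * ∫⁻ x in Ioi (0:ℝ), G x := by
  have h1 : ∫⁻ x : ℝ, (Ioi (0:ℝ)).indicator G (-x) = ∫⁻ x in Ioi (0:ℝ), G x := by
    rw [← lintegral_indicator measurableSet_Ioi]
    exact lintegral_neg_eq_self (μ := volume) ((Ioi (0:ℝ)).indicator G)
  calc ∫⁻ x : ℝ, G |x| ≤ ∫⁻ x : ℝ, ((Ioi (0:ℝ)).indicator G x + (Ioi (0:ℝ)).indicator G (-x)) := by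
        apply lintegral_mono_ae
        filter_upwards [Measure.ae_ne volume (0:ℝ)] with x hx
        rcases lt_or_gt_of_ne hx with h | h
        · have : x ∉ Ioi (0:ℝ) := by simp [h.le]
          have h2 : -x ∈ Ioi (0:ℝ) := by simp [h]
          rw [indicator_of_notMem this, indicator_of_mem h2, abs_of_neg h, zero_add]
        · have : x ∈ Ioi (0:ℝ) := h
          rw [indicator_of_mem this, abs_of_pos h]
          exact le_self_add
    _ = _ := by
        rw [lintegral_add_left (hG.indicator measurableSet_Ioi), h1,
          lintegral_indicator measurableSet_Ioi, two_mul]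

lemma aux_exp : ∫⁻ x : ℝ, ENNReal.ofReal (Real.exp (-(|x| / 2))) ≠ ⊤ := by
  have h := aux_even (fun x => ENNReal.ofReal (Real.exp (-(x / 2)))) (by fun_prop)
  have hi := integrableOn_exp_mul_Ioi (a := -(1/2)) (by norm_num) 0
  have hlt := hi.lintegral_lt_top
  have e : ∀ x : ℝ, -(1/2) * x = -(x/2) := fun x => by ring
  simp only [e] at hlt
  exact (h.trans_lt (ENNReal.mul_lt_top (by simp) hlt)).ne

lemma aux_pow (σ : ℝ) (hσ : -1 < σ) :
    ∫⁻ x : ℝ, (Iic (1:ℝ)).indicator (fun y => ENNReal.ofReal (y ^ σ)) |x| ≠ ⊤ := by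
  have hm : Measurable (fun y : ℝ => ENNReal.ofReal (y ^ σ)) := by fun_prop
  have h := aux_even _ (hm.indicator (measurableSet_Iic (a := (1:ℝ))))
  have hi : IntegrableOn (fun x : ℝ => x ^ σ) (Ioc 0 1) := by
    have := intervalIntegral.intervalIntegrable_rpow' (a := 0) (b := 1) hσ
    rwa [intervalIntegrable_iff_integrableOn_Ioc_of_le zero_le_one] at this
  have hlt := hi.lintegral_lt_top
  rw [lintegral_indicator measurableSet_Iic, Measure.restrict_restrict measurableSet_Iic,
    Iic_inter_Ioi] at h
  exact (h.trans_lt (ENNReal.mul_lt_top (by simp) hlt)).ne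

lemma aux_rho (σ x : ℝ) (hx : 0 < x) :
    x ^ σ * (1 + x) ^ (-σ) ≤ 2 ^ |σ| * (1 + (Iic (1:ℝ)).indicator (fun y => y ^ σ) x) := by
  have h1 : (0:ℝ) < 1 + x := by linarith
  have hK : (1:ℝ) ≤ 2 ^ |σ| := Real.one_le_rpow (by norm_num) (abs_nonneg _)
  have hind : 0 ≤ (Iic (1:ℝ)).indicator (fun y => y ^ σ) x := by
    by_cases h : x ∈ Iic (1:ℝ)
    · rw [indicator_of_mem h]; positivity
    · rw [indicator_of_notMem h]
  have e : x ^ σ * (1 + x) ^ (-σ) = (x / (1 + x)) ^ σ := by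
    rw [Real.div_rpow hx.le h1.le, Real.rpow_neg h1.le]; rfl
  rcases le_total 0 σ with hs | hs
  · have : (x / (1 + x)) ^ σ ≤ 1 :=
      Real.rpow_le_one (by positivity) ((div_le_one h1).2 (by linarith)) hs
    rw [e]; nlinarith
  · have ha : |σ| = -σ := abs_of_nonpos hs
    by_cases hx1 : x ≤ 1
    · have : x ∈ Iic (1:ℝ) := hx1
      rw [indicator_of_mem this, ha] at *
      have h2 : (1 + x) ^ (-σ) ≤ 2 ^ (-σ) :=
        Real.rpow_le_rpow h1.le (by linarith) (by linarith)
      have h3 : 0 < x ^ σ := by positivity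
      have h4 : (0:ℝ) < 2 ^ (-σ) := by positivity
      nlinarith
    · have hx1 : 1 < x := not_le.1 hx1
      have : (x / (1 + x)) ^ σ ≤ (1/2) ^ σ :=
        Real.rpow_le_rpow_of_nonpos (by norm_num)
          (by rw [div_le_div_iff₀ (by norm_num) h1]; linarith) hs
      have h4 : ((1:ℝ)/2) ^ σ = 2 ^ |σ| := by
        rw [ha, Real.rpow_neg (by norm_num), one_div, Real.inv_rpow (by norm_num)]
      rw [e]; nlinarith

/-- Uniform bound of the averaged ratio. -/
lemma aux_B (σ : ℝ) (hσ : -1 < σ) : ∃ C : ℝ≥0∞, C ≠ ⊤ ∧ ∀ t : ℝ,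
    ∫⁻ s : ℝ, ENNReal.ofReal (Real.exp (-(|s - t| / 2)) * (|s| ^ σ * (1 + |s|) ^ (-σ))) ≤ C := by
  refine ⟨ENNReal.ofReal (2 ^ |σ|) * ((∫⁻ x : ℝ, ENNReal.ofReal (Real.exp (-(|x| / 2)))) +
    ∫⁻ x : ℝ, (Iic (1:ℝ)).indicator (fun y => ENNReal.ofReal (y ^ σ)) |x|), ?_, ?_⟩
  · exact ENNReal.mul_ne_top (by simp) (ENNReal.add_ne_top.2 ⟨aux_exp, aux_pow σ hσ⟩)
  · intro t
    have ht : ∫⁻ x : ℝ, ENNReal.ofReal (Real.exp (-(|x| / 2)))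
        = ∫⁻ x : ℝ, ENNReal.ofReal (Real.exp (-(|x - t| / 2))) :=
      (lintegral_sub_right_eq_self (fun x => ENNReal.ofReal (Real.exp (-(|x| / 2)))) t).symm
    rw [ht, ← lintegral_add_left (by fun_prop), ← lintegral_const_mul' _ _ (by simp)]
    apply lintegral_mono_ae
    filter_upwards [Measure.ae_ne volume (0:ℝ)] with s hs
    have h := aux_rho σ |s| (abs_pos.2 hs)
    have he : Real.exp (-(|s - t| / 2)) ≤ 1 := Real.exp_le_one_iff.2 (by simp; positivity)
    have he0 := Real.exp_pos (-(|s - t| / 2))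
    have hi : (Iic (1:ℝ)).indicator (fun y => ENNReal.ofReal (y ^ σ)) |s|
        = ENNReal.ofReal ((Iic (1:ℝ)).indicator (fun y => y ^ σ) |s|) := by
      by_cases h : |s| ∈ Iic (1:ℝ)
      · simp only [indicator_of_mem h]
      · simp only [indicator_of_notMem h]; simp
    have hind : 0 ≤ (Iic (1:ℝ)).indicator (fun y => y ^ σ) |s| := by
      by_cases h : |s| ∈ Iic (1:ℝ)
      · rw [indicator_of_mem h]; positivity
      · rw [indicator_of_notMem h]
    rw [hi, ← ENNReal.ofReal_add he0.le hind, ← ENNReal.ofReal_mul (by positivity)]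
    apply ENNReal.ofReal_le_ofReal
    have hK : (0:ℝ) < 2 ^ |σ| := by positivity
    calc _ ≤ Real.exp (-(|s - t| / 2)) *
          (2 ^ |σ| * (1 + (Iic (1:ℝ)).indicator (fun y => y ^ σ) |s|)) := by gcongr
      _ = 2 ^ |σ| * (Real.exp (-(|s - t| / 2)) + Real.exp (-(|s - t| / 2)) *
          (Iic (1:ℝ)).indicator (fun y => y ^ σ) |s|) := by ring
      _ ≤ _ := by
        gcongr
        nlinarith

/-- Peetre type inequality. -/
lemma aux_peetre (σ s t : ℝ) :
    Real.exp (-(|s - t| / 2)) * (1 + |s|) ^ σ ≤ (2 * |σ| + 1) ^ |σ| * (1 + |t|) ^ σ := by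
  set u := |s - t| with hu
  have hu0 : 0 ≤ u := abs_nonneg _
  have ha := abs_nonneg σ
  have hs0 : 0 ≤ |s| := abs_nonneg s
  have ht0 : 0 ≤ |t| := abs_nonneg t
  have hN : 0 < 2 * |σ| + 1 := by linarith
  have h1 : (1 + |s|) ^ σ ≤ (1 + u) ^ |σ| * (1 + |t|) ^ σ := by
    rcases le_total 0 σ with h | h
    · rw [abs_of_nonneg h, ← Real.mul_rpow (by positivity) (by positivity)]
      apply Real.rpow_le_rpow (by positivity) _ h
      have : |s| ≤ u + |t| := by
        have := abs_add_le (s - t) t; simpa using this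
      nlinarith
    · rw [abs_of_nonpos h]
      have h3 : 1 + |t| ≤ (1 + u) * (1 + |s|) := by
        have : |t| ≤ u + |s| := by
          have := abs_add_le (t - s) s; rw [abs_sub_comm t s] at this; simpa using this
        nlinarith
      have h4 := Real.rpow_le_rpow_of_nonpos (by positivity) h3 h
      rw [Real.mul_rpow (by positivity) (by positivity)] at h4
      rw [Real.rpow_neg (by positivity)]
      have h5 : 0 < (1 + u) ^ σ := by positivity
      rw [inv_mul_eq_div, le_div_iff₀ h5]; linarith
  have h2 : (1 + u) ^ |σ| ≤ (2 * |σ| + 1) ^ |σ| * Real.exp (u / 2) := by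
    have h3 : 1 + u ≤ (2 * |σ| + 1) * Real.exp (u / (2 * |σ| + 1)) := by
      have h4 := Real.add_one_le_exp (u / (2 * |σ| + 1))
      have h5 : (2 * |σ| + 1) * (u / (2 * |σ| + 1) + 1) = u + (2 * |σ| + 1) := by field_simp
      nlinarith
    calc (1 + u) ^ |σ| ≤ ((2 * |σ| + 1) * Real.exp (u / (2 * |σ| + 1))) ^ |σ| :=
          Real.rpow_le_rpow (by positivity) h3 ha
      _ = (2 * |σ| + 1) ^ |σ| * Real.exp (u / (2 * |σ| + 1) * |σ|) := by
          rw [Real.mul_rpow hN.le (Real.exp_pos _).le, ← Real.exp_mul]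
      _ ≤ _ := by
          gcongr
          rw [div_mul_eq_mul_div, div_le_div_iff₀ hN (by norm_num)]
          nlinarith
  calc Real.exp (-(u / 2)) * (1 + |s|) ^ σ
      ≤ Real.exp (-(u / 2)) * (((2 * |σ| + 1) ^ |σ| * Real.exp (u / 2)) * (1 + |t|) ^ σ) := by
        gcongr
        exact h1.trans (by gcongr)
    _ = (Real.exp (-(u / 2)) * Real.exp (u / 2)) * ((2 * |σ| + 1) ^ |σ| * (1 + |t|) ^ σ) := by
        ring
    _ = _ := by rw [← Real.exp_add]; simp

lemma aux_A (σ : ℝ) (hσ : -1 < σ) : ∃ C : ℝ≥0∞, C ≠ ⊤ ∧ ∀ t : ℝ,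
    ∫⁻ s : ℝ, ENNReal.ofReal (Real.exp (-|s - t|)) * ENNReal.ofReal (|s| ^ σ)
      ≤ C * ENNReal.ofReal ((1 + |t|) ^ σ) := by
  obtain ⟨C, hC, h⟩ := aux_B σ hσ
  refine ⟨ENNReal.ofReal ((2 * |σ| + 1) ^ |σ|) * C, ENNReal.mul_ne_top (by simp) hC, fun t => ?_⟩
  have hN : 0 ≤ (2 * |σ| + 1) ^ |σ| := by positivity
  calc _ ≤ ∫⁻ s : ℝ, ENNReal.ofReal ((2 * |σ| + 1) ^ |σ| * (1 + |t|) ^ σ) *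
        ENNReal.ofReal (Real.exp (-(|s - t| / 2)) * (|s| ^ σ * (1 + |s|) ^ (-σ))) := by
        apply lintegral_mono
        intro s
        dsimp only
        rw [← ENNReal.ofReal_mul (by positivity), ← ENNReal.ofReal_mul (by positivity)]
        apply ENNReal.ofReal_le_ofReal
        have hp := aux_peetre σ s t
        have e1 : Real.exp (-|s - t|) = Real.exp (-(|s - t| / 2)) * Real.exp (-(|s - t| / 2)) := by
          rw [← Real.exp_add]; ring_nf
        have e2 : (1 + |s|) ^ σ * (1 + |s|) ^ (-σ) = 1 := by
          rw [← Real.rpow_add (by positivity)]; simp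
        calc Real.exp (-|s - t|) * |s| ^ σ
            = (Real.exp (-(|s - t| / 2)) * (1 + |s|) ^ σ) *
              (Real.exp (-(|s - t| / 2)) * (|s| ^ σ * (1 + |s|) ^ (-σ))) := by
              rw [e1]
              linear_combination (-Real.exp (-(|s - t| / 2)) * Real.exp (-(|s - t| / 2))
                * |s| ^ σ) * e2
          _ ≤ _ := by gcongr
    _ = ENNReal.ofReal ((2 * |σ| + 1) ^ |σ| * (1 + |t|) ^ σ) * ∫⁻ s : ℝ,
        ENNReal.ofReal (Real.exp (-(|s - t| / 2)) * (|s| ^ σ * (1 + |s|) ^ (-σ))) :=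
        lintegral_const_mul' _ _ (by simp)
    _ ≤ ENNReal.ofReal ((2 * |σ| + 1) ^ |σ| * (1 + |t|) ^ σ) * C := by gcongr; exact h t
    _ = _ := by rw [ENNReal.ofReal_mul hN]; ring

lemma aux_holder_s18 (p γ : ℝ) (hp : 1 < p) (F : ℝ → ℝ≥0∞) (hF : Measurable F) (t : ℝ) :
    (∫⁻ s : ℝ, ENNReal.ofReal (Real.exp (-|s - t|)) * F s) ^ p ≤
      (∫⁻ s : ℝ, ENNReal.ofReal (Real.exp (-|s - t|)) * ENNReal.ofReal (|s| ^ (-γ / (p - 1))))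
        ^ (p - 1) *
      ∫⁻ s : ℝ, ENNReal.ofReal (Real.exp (-|s - t|)) * (ENNReal.ofReal (|s| ^ γ) * F s ^ p) := by
  have hp0 : 0 < p := by linarith
  have hp1 : 0 < p - 1 := by linarith
  have ha : 0 ≤ (p - 1) / p := by positivity
  have hb : 0 ≤ 1 / p := by positivity
  have h := ENNReal.lintegral_mul_norm_pow_le (μ := (volume : Measure ℝ))
    (f := fun s => ENNReal.ofReal (Real.exp (-|s - t|)) * ENNReal.ofReal (|s| ^ (-γ / (p - 1))))
    (g := fun s => ENNReal.ofReal (Real.exp (-|s - t|)) * (ENNReal.ofReal (|s| ^ γ) * F s ^ p))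
    (by fun_prop) (by fun_prop) ha hb (by field_simp; ring)
  have e : ∫⁻ s : ℝ, ENNReal.ofReal (Real.exp (-|s - t|)) * F s =
      ∫⁻ s : ℝ, (ENNReal.ofReal (Real.exp (-|s - t|)) * ENNReal.ofReal (|s| ^ (-γ / (p - 1))))
        ^ ((p - 1) / p) *
      (ENNReal.ofReal (Real.exp (-|s - t|)) * (ENNReal.ofReal (|s| ^ γ) * F s ^ p)) ^ (1 / p) := by
    apply lintegral_congr_ae
    filter_upwards [Measure.ae_ne volume (0:ℝ)] with s hs
    have hs' := abs_pos.2 hs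
    rw [ENNReal.mul_rpow_of_nonneg _ _ ha, ENNReal.mul_rpow_of_nonneg _ _ hb,
      ENNReal.mul_rpow_of_nonneg _ _ hb, ← ENNReal.rpow_mul, mul_one_div_cancel hp0.ne',
      ENNReal.rpow_one]
    have e1 : ENNReal.ofReal (Real.exp (-|s - t|)) ^ ((p - 1) / p) *
        ENNReal.ofReal (Real.exp (-|s - t|)) ^ (1 / p) = ENNReal.ofReal (Real.exp (-|s - t|)) := by
      rw [← ENNReal.rpow_add_of_nonneg _ _ ha hb]
      have : (p - 1) / p + 1 / p = 1 := by field_simp; ring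
      rw [this, ENNReal.rpow_one]
    have e2 : ENNReal.ofReal (|s| ^ (-γ / (p - 1))) ^ ((p - 1) / p) *
        ENNReal.ofReal (|s| ^ γ) ^ (1 / p) = 1 := by
      rw [ENNReal.ofReal_rpow_of_nonneg (by positivity) ha,
        ENNReal.ofReal_rpow_of_nonneg (by positivity) hb, ← ENNReal.ofReal_mul (by positivity),
        ← Real.rpow_mul hs'.le, ← Real.rpow_mul hs'.le, ← Real.rpow_add hs']
      have : -γ / (p - 1) * ((p - 1) / p) + γ * (1 / p) = 0 := by field_simp; ring
      rw [this]; simp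
    calc _ = (ENNReal.ofReal (Real.exp (-|s - t|)) ^ ((p - 1) / p) *
        ENNReal.ofReal (Real.exp (-|s - t|)) ^ (1 / p)) * (ENNReal.ofReal (|s| ^ (-γ / (p - 1))) ^ ((p - 1) / p) *
        ENNReal.ofReal (|s| ^ γ) ^ (1 / p)) * F s := by rw [e1, e2, mul_one]
      _ = _ := by ring
  rw [e]
  refine (ENNReal.rpow_le_rpow h hp0.le).trans (le_of_eq ?_)
  rw [ENNReal.mul_rpow_of_nonneg _ _ hp0.le, ← ENNReal.rpow_mul, ← ENNReal.rpow_mul,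
    div_mul_cancel₀ _ hp0.ne', div_mul_cancel₀ _ hp0.ne', ENNReal.rpow_one]

lemma aux_core (p γ : ℝ) (hp : 1 < p) (hγ₁ : -1 < γ) (hγ₂ : γ < p - 1) :
    ∃ C : ℝ≥0∞, C ≠ ⊤ ∧ ∀ F : ℝ → ℝ≥0∞, Measurable F →
      ∫⁻ t : ℝ, ENNReal.ofReal (|t| ^ γ) *
        (∫⁻ s : ℝ, ENNReal.ofReal (Real.exp (-|s - t|)) * F s) ^ p ≤
      C * ∫⁻ t : ℝ, ENNReal.ofReal (|t| ^ γ) * F t ^ p := by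
  have hp1 : 0 < p - 1 := by linarith
  obtain ⟨C₁, hC₁, h₁⟩ := aux_A (-γ / (p - 1)) (by rw [lt_div_iff₀ hp1]; linarith)
  obtain ⟨C₂, hC₂, h₂⟩ := aux_B γ hγ₁
  have hC₁' : C₁ ^ (p - 1) ≠ ⊤ := ENNReal.rpow_ne_top_of_nonneg hp1.le hC₁
  refine ⟨C₁ ^ (p - 1) * C₂, ENNReal.mul_ne_top hC₁' hC₂, fun F hF => ?_⟩
  calc _ ≤ ∫⁻ t : ℝ, C₁ ^ (p - 1) * ∫⁻ s : ℝ,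
        ENNReal.ofReal (Real.exp (-(|t - s| / 2)) * (|t| ^ γ * (1 + |t|) ^ (-γ))) *
          (ENNReal.ofReal (|s| ^ γ) * F s ^ p) := by
        apply lintegral_mono
        intro t
        dsimp only
        have hm : ENNReal.ofReal ((1 + |t|) ^ (-γ / (p - 1))) ^ (p - 1)
            = ENNReal.ofReal ((1 + |t|) ^ (-γ)) := by
          rw [ENNReal.ofReal_rpow_of_nonneg (by positivity) hp1.le,
            ← Real.rpow_mul (by positivity), div_mul_cancel₀ _ hp1.ne']
        calc _ ≤ ENNReal.ofReal (|t| ^ γ) * ((C₁ * ENNReal.ofReal ((1 + |t|) ^ (-γ / (p - 1))))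
              ^ (p - 1) * ∫⁻ s : ℝ, ENNReal.ofReal (Real.exp (-|s - t|)) *
                (ENNReal.ofReal (|s| ^ γ) * F s ^ p)) := by
              gcongr
              refine (aux_holder_s18 p γ hp F hF t).trans ?_
              gcongr
              exact h₁ t
          _ = C₁ ^ (p - 1) * (ENNReal.ofReal (|t| ^ γ * (1 + |t|) ^ (-γ)) * ∫⁻ s : ℝ,
                ENNReal.ofReal (Real.exp (-|s - t|)) *
                (ENNReal.ofReal (|s| ^ γ) * F s ^ p)) := by
              rw [ENNReal.mul_rpow_of_nonneg _ _ hp1.le, hm, ENNReal.ofReal_mul (by positivity)]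
              ring
          _ ≤ _ := by
              rw [← lintegral_const_mul' _ _ (by simp)]
              refine mul_le_mul_right (lintegral_mono fun s => ?_) _
              dsimp only
              rw [← mul_assoc, ← ENNReal.ofReal_mul (by positivity), mul_comm (|t| ^ γ * _),
                abs_sub_comm s t]
              gcongr
              have := abs_nonneg (t - s)
              linarith
    _ = C₁ ^ (p - 1) * ∫⁻ s : ℝ, ∫⁻ t : ℝ,
        ENNReal.ofReal (Real.exp (-(|t - s| / 2)) * (|t| ^ γ * (1 + |t|) ^ (-γ))) *
          (ENNReal.ofReal (|s| ^ γ) * F s ^ p) := by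
        rw [lintegral_const_mul' _ _ hC₁', lintegral_lintegral_swap]
        refine Measurable.aemeasurable ?_
        unfold Function.uncurry
        fun_prop
    _ ≤ C₁ ^ (p - 1) * ∫⁻ s : ℝ, C₂ * (ENNReal.ofReal (|s| ^ γ) * F s ^ p) := by
        gcongr with s
        rw [lintegral_mul_const _ (by fun_prop)]
        gcongr
        exact h₂ s
    _ = _ := by
        rw [lintegral_const_mul' _ _ hC₂, mul_assoc]

lemma aux_scale (lam : ℝ) (hl : 0 < lam) (H : ℝ → ℝ≥0∞) (hH : Measurable H) :
    ∫⁻ x : ℝ, ENNReal.ofReal lam * H (lam * x) = ∫⁻ x, H x := by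
  have h := Real.smul_map_volume_mul_left hl.ne'
  conv_rhs => rw [← h]
  rw [lintegral_smul_measure, lintegral_map hH (by fun_prop), abs_of_pos hl,
    lintegral_const_mul' _ _ (by simp), smul_eq_mul]

lemma aux_core_scaled (p γ : ℝ) (hp : 1 < p) (hγ₁ : -1 < γ) (hγ₂ : γ < p - 1) :
    ∃ C : ℝ≥0∞, C ≠ ⊤ ∧ ∀ lam : ℝ, 0 < lam → ∀ F : ℝ → ℝ≥0∞, Measurable F →
      ∫⁻ t : ℝ, ENNReal.ofReal (|t| ^ γ) *
        (∫⁻ s : ℝ, ENNReal.ofReal lam * (ENNReal.ofReal (Real.exp (-(lam * |s - t|))) * F s)) ^ p ≤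
      C * ∫⁻ t : ℝ, ENNReal.ofReal (|t| ^ γ) * F t ^ p := by
  obtain ⟨C, hC, h⟩ := aux_core p γ hp hγ₁ hγ₂
  refine ⟨C, hC, fun lam hl F hF => ?_⟩
  have hF' : Measurable (fun x => F (lam⁻¹ * x)) := by fun_prop
  have key := h _ hF'
  have hT : ∀ t : ℝ, ∫⁻ s : ℝ, ENNReal.ofReal lam *
      (ENNReal.ofReal (Real.exp (-(lam * |s - t|))) * F s)
      = ∫⁻ s : ℝ, ENNReal.ofReal (Real.exp (-|s - lam * t|)) * F (lam⁻¹ * s) := by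
    intro t
    rw [← aux_scale lam hl (fun s => ENNReal.ofReal (Real.exp (-|s - lam * t|)) * F (lam⁻¹ * s))
      (by fun_prop)]
    congr 1 with s
    rw [← mul_sub, abs_mul, abs_of_pos hl, inv_mul_cancel_left₀ hl.ne']
  simp only [hT]
  have hTm : Measurable (fun t : ℝ =>
      ∫⁻ s : ℝ, ENNReal.ofReal (Real.exp (-|s - t|)) * F (lam⁻¹ * s)) := by
    apply Measurable.lintegral_prod_right'
      (f := fun z : ℝ × ℝ => ENNReal.ofReal (Real.exp (-|z.2 - z.1|)) * F (lam⁻¹ * z.2))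
    fun_prop
  rw [← aux_scale lam hl (fun t => ENNReal.ofReal (|t| ^ γ) *
      (∫⁻ s : ℝ, ENNReal.ofReal (Real.exp (-|s - t|)) * F (lam⁻¹ * s)) ^ p) (by fun_prop),
    ← aux_scale lam hl (fun t => ENNReal.ofReal (|t| ^ γ) * F (lam⁻¹ * t) ^ p)
      (by fun_prop)] at key
  have hc : ENNReal.ofReal lam * ENNReal.ofReal (lam ^ γ) ≠ 0 := by
    simp [hl, Real.rpow_pos_of_pos hl]
  have hc' : ENNReal.ofReal lam * ENNReal.ofReal (lam ^ γ) ≠ ⊤ :=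
    ENNReal.mul_ne_top (by simp) (by simp)
  have e : ∀ (x : ℝ) (A : ℝ≥0∞), ENNReal.ofReal lam * (ENNReal.ofReal (|lam * x| ^ γ) * A) =
      (ENNReal.ofReal lam * ENNReal.ofReal (lam ^ γ)) * (ENNReal.ofReal (|x| ^ γ) * A) := by
    intro x A
    rw [abs_mul, abs_of_pos hl, Real.mul_rpow hl.le (abs_nonneg _),
      ENNReal.ofReal_mul (by positivity)]
    ring
  simp only [e, inv_mul_cancel_left₀ hl.ne'] at key
  rw [lintegral_const_mul' _ _ hc', lintegral_const_mul' _ _ hc', mul_left_comm] at key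
  exact (ENNReal.mul_le_mul_iff_right hc hc').1 key

/-- For `p ∈ (1,∞)` and `γ ∈ (-1, p-1)`, the operators
`K_λ f(t) = λ ∫_t^∞ e^{-λ(s-t)} f(s) ds` are bounded on `L^p(ℝ, |t|^γ dt; X)`
uniformly in `λ > 0`. -/
theorem uniform_resolvent_bound_weighted
    (p γ : ℝ) (hp : 1 < p) (hγ₁ : -1 < γ) (hγ₂ : γ < p - 1) :
    ∃ C : ℝ≥0∞, C ≠ ⊤ ∧ ∀ lam : ℝ, 0 < lam → ∀ f : ℝ → X,
      AEStronglyMeasurable f volume → wLpNormR p γ f < ⊤ →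
        (∀ᵐ t : ℝ, IntegrableOn (fun s => Real.exp (-lam * (s - t)) • f s) (Ioi t)) ∧
        wLpNormR p γ (Kop lam f) ≤ C * wLpNormR p γ f := by
  have hp0 : 0 < p := by linarith
  obtain ⟨C, hC, h⟩ := aux_core_scaled p γ hp hγ₁ hγ₂
  refine ⟨C ^ (1 / p), ENNReal.rpow_ne_top_of_nonneg (by positivity) hC, fun lam hl f hf hfin => ?_⟩
  obtain ⟨g, hg, hfg⟩ := hf
  have hgm : Measurable (fun s => ‖g s‖ₑ) := hg.enorm
  have key := h lam hl _ hgm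
  set T : ℝ → ℝ≥0∞ := fun t => ∫⁻ s : ℝ, ENNReal.ofReal lam *
    (ENNReal.ofReal (Real.exp (-(lam * |s - t|))) * ‖g s‖ₑ) with hT
  have hTm : Measurable T := by
    apply Measurable.lintegral_prod_right' (f := fun z : ℝ × ℝ => ENNReal.ofReal lam *
      (ENNReal.ofReal (Real.exp (-(lam * |z.2 - z.1|))) * ‖g z.2‖ₑ))
    fun_prop
  change ∫⁻ t : ℝ, ENNReal.ofReal (|t| ^ γ) * T t ^ p ≤ _ at key
  have hfge : ∫⁻ t : ℝ, ENNReal.ofReal (|t| ^ γ) * (‖f t‖₊ : ℝ≥0∞) ^ p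
      = ∫⁻ t : ℝ, ENNReal.ofReal (|t| ^ γ) * ‖g t‖ₑ ^ p := by
    apply lintegral_congr_ae
    filter_upwards [hfg] with t ht
    rw [ht]; rfl
  -- pointwise domination
  have hdom : ∀ t, ENNReal.ofReal lam *
      (∫⁻ s in Ioi t, ‖Real.exp (-lam * (s - t)) • f s‖ₑ) ≤ T t := by
    intro t
    rw [← lintegral_const_mul' _ _ (by simp)]
    refine le_trans (lintegral_mono_ae ?_) (setLIntegral_le_lintegral (Ioi t) _)
    filter_upwards [ae_restrict_of_ae hfg, ae_restrict_mem measurableSet_Ioi] with s hs hst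
    have hst : t < s := hst
    rw [enorm_smul, hs, abs_of_pos (sub_pos.2 hst), Real.enorm_of_nonneg (Real.exp_pos _).le,
      neg_mul]
  have hnfin : ∫⁻ t : ℝ, ENNReal.ofReal (|t| ^ γ) * ‖g t‖ₑ ^ p ≠ ⊤ := by
    intro htop
    unfold wLpNormR at hfin
    rw [hfge, htop, ENNReal.top_rpow_of_pos (by positivity)] at hfin
    exact lt_irrefl _ hfin
  constructor
  · have hlt := ae_lt_top' (by fun_prop) (ne_top_of_le_ne_top (ENNReal.mul_ne_top hC hnfin) key)
    filter_upwards [hlt, Measure.ae_ne volume (0:ℝ)] with t ht ht0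
    have hTt : T t < ⊤ := by
      by_contra hcon
      rw [not_lt_top_iff] at hcon
      rw [hcon, ENNReal.top_rpow_of_pos hp0, ENNReal.mul_top] at ht
      · exact lt_irrefl _ ht
      · have := Real.rpow_pos_of_pos (abs_pos.2 ht0) γ
        simpa using this
    have hf : AEStronglyMeasurable f volume := ⟨g, hg, hfg⟩
    refine ⟨?_, ?_⟩
    · have : AEStronglyMeasurable (fun s : ℝ => Real.exp (-lam * (s - t))) volume :=
        (by fun_prop : Continuous _).aestronglyMeasurable
      exact (this.smul hf).restrict
    · have h1 := (hdom t).trans_lt hTt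
      unfold HasFiniteIntegral
      by_contra hcon
      rw [not_lt_top_iff] at hcon
      rw [hcon, ENNReal.mul_top (by simpa using hl)] at h1
      exact lt_irrefl _ h1
  · unfold wLpNormR
    rw [hfge, ← ENNReal.mul_rpow_of_nonneg _ _ (by positivity)]
    apply ENNReal.rpow_le_rpow _ (by positivity)
    refine le_trans (lintegral_mono fun t => ?_) key
    dsimp only
    gcongr
    refine le_trans ?_ (hdom t)
    change ‖Kop lam f t‖ₑ ≤ _
    unfold Kop
    rw [enorm_smul, Real.enorm_of_nonneg hl.le]
    gcongr
    exact enorm_integral_le_lintegral_enorm _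
end
end
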